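/- arXiv:1104.4412 — 2 statements merged into one kernel-verified Lean document; each statement's English description precedes it below -/
import Mathlib

section
/- There exists N such that the following holds for all n ≥ N. Let G be an (r_G/n)-pseudorandom graph on n vertices with r_G ≥ 2(log n)², and let H be an even-regular spanning subgraph of G of degree r_H with δ(G) − 1 ≤ r_H ≤ δ(G). Let H' be an arbitrary even-regular graph of degree r_{H'} on the same vertex set, edge-disjoint from H, and let E_bad ⊆ E(H'). Suppose r_{H'} + 1 + 10⁶·|E_bad|/n ≤ r_G/5000, and let m = (r_H + r_{H'})/2. Then the edge set of H ∪ H' can be partitioned into 2-factors F₁,…,F_m such that c(F₁) + … + c(F_m) ≤ 4n√(r_G·(log n)³) and each set E(Fᵢ) ∩ E_bad is a matching of size at most n/10⁶, where c(F) denotes the number of cycles of F. -/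
open scoped Classical
open SimpleGraph

namespace EDHC

/-- Degree of a vertex (as cardinality of its neighbour set). -/
noncomputable def deg {V : Type} (G : SimpleGraph V) (v : V) : ℕ := (G.neighborSet v).ncard

/-- Minimum degree. -/
noncomputable def minDeg {V : Type} (G : SimpleGraph V) : ℕ := sInf (Set.range (deg G))

/-- Maximum degree. -/
noncomputable def maxDeg {V : Type} (G : SimpleGraph V) : ℕ := sSup (Set.range (deg G))

/-- Number of edges of `G` with both endpoints in `S`. -/
noncomputable def eIn {V : Type} (G : SimpleGraph V) (S : Set V) : ℕ :=
  {e ∈ G.edgeSet | ∀ v ∈ e, v ∈ S}.ncard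

/-- Number of edges of `G` with one endpoint in `S` and the other in `T`. -/
noncomputable def eBtw {V : Type} (G : SimpleGraph V) (S T : Set V) : ℕ :=
  {e ∈ G.edgeSet | ∃ a ∈ S, ∃ b ∈ T, e = s(a, b)}.ncard

/-- `G` is `(p, β)`-jumbled. -/
def IsJumbled {V : Type} (G : SimpleGraph V) (p β : ℝ) : Prop :=
  ∀ S : Set V, |(eIn G S : ℝ) - p * ((S.ncard : ℝ) * ((S.ncard : ℝ) - 1) / 2)| ≤ β * S.ncard

/-- `G` is strongly `2`-jumping. -/
def StronglyTwoJumping (n : ℕ) (G : SimpleGraph (Fin n)) : Prop :=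
  ∀ T : Set (Fin n), T.Nonempty →
    (∑ v ∈ (Set.toFinite T).toFinset, (deg G v : ℝ)) / (T.ncard : ℝ) ≥
      (minDeg G : ℝ) + min ((T.ncard : ℝ) - 1) ((Real.log n) ^ 2)

/-- `G` is `p`-pseudorandom. -/
def IsPseudorandom (n : ℕ) (G : SimpleGraph (Fin n)) (p : ℝ) : Prop :=
  IsJumbled G p (2 * Real.sqrt (n * p * (1 - p))) ∧
  (∀ S T : Set (Fin n), Disjoint S T →
    ((1 / (S.ncard : ℝ) + 1 / (T.ncard : ℝ)) * Real.log n / p ≥ 7 / 2 →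
      (eBtw G S T : ℝ) ≤ 2 * ((S.ncard : ℝ) + (T.ncard : ℝ)) * Real.log n) ∧
    ((1 / (S.ncard : ℝ) + 1 / (T.ncard : ℝ)) * Real.log n / p ≤ 7 / 2 →
      (eBtw G S T : ℝ) ≤ 7 * (S.ncard : ℝ) * (T.ncard : ℝ) * p)) ∧
  (∀ S : Set (Fin n),
    (Real.log n / ((S.ncard : ℝ) * p) ≥ 7 / 4 → (eIn G S : ℝ) ≤ 2 * (S.ncard : ℝ) * Real.log n) ∧
    (Real.log n / ((S.ncard : ℝ) * p) ≤ 7 / 4 → (eIn G S : ℝ) ≤ 7 * (S.ncard : ℝ) ^ 2 * p / 2)) ∧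
  ((n : ℝ) * p - 2 * Real.sqrt ((n : ℝ) * p * Real.log n) ≤ (minDeg G : ℝ) ∧
    (minDeg G : ℝ) ≤ (n : ℝ) * p - 200 * Real.sqrt ((n : ℝ) * p * (1 - p)) ∧
    (maxDeg G : ℝ) ≤ (n : ℝ) * p + 2 * Real.sqrt ((n : ℝ) * p * Real.log n)) ∧
  StronglyTwoJumping n G

/-- `G` is `u`-jumping. -/
def IsJumping (n : ℕ) (G : SimpleGraph (Fin n)) (u : ℝ) : Prop :=
  ∃ x₀ : Fin n, deg G x₀ = minDeg G ∧
    ∀ x : Fin n, x ≠ x₀ → (deg G x : ℝ) ≥ (minDeg G : ℝ) + u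

/-- `C` is a Hamilton cycle (on the whole vertex set `Fin n`). -/
def IsHamCycle {n : ℕ} (C : SimpleGraph (Fin n)) : Prop :=
  ∃ (v : Fin n) (w : C.Walk v v), w.IsHamiltonianCycle ∧ C.edgeSet = {e | e ∈ w.edges}

/-- `G` has property `H`. -/
def HasPropertyH (n : ℕ) (G : SimpleGraph (Fin n)) : Prop :=
  ∃ HC : Fin (minDeg G / 2) → SimpleGraph (Fin n),
    (∀ i, HC i ≤ G ∧ IsHamCycle (HC i)) ∧
    (∀ i j, i ≠ j → Disjoint (HC i).edgeSet (HC j).edgeSet) ∧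
    (Odd (minDeg G) →
      ∃ M : SimpleGraph (Fin n), M ≤ G ∧ (∀ v, deg M v ≤ 1) ∧
        M.edgeSet.ncard = n / 2 ∧ ∀ i, Disjoint M.edgeSet (HC i).edgeSet)

/-- Probability of the event `A` under the binomial random graph `G_{n,p}`. -/
noncomputable def gnpProb (n : ℕ) (p : ℝ) (A : SimpleGraph (Fin n) → Prop) : ℝ :=
  ∑ G : SimpleGraph (Fin n),
    if A G then p ^ G.edgeSet.ncard * (1 - p) ^ (n.choose 2 - G.edgeSet.ncard) else 0


/-- Number of cycles of a 2-regular graph = number of connected components. -/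
noncomputable def numCycles {V : Type} (F : SimpleGraph V) : ℕ := Nat.card F.ConnectedComponent

/-- `N` is a perfect matching on the whole vertex set. -/
def IsPerfectMatchingGraph {n : ℕ} (N : SimpleGraph (Fin n)) : Prop :=
  ∀ v, ((N.neighborSet v).ncard) = 1

/-- `N` is a perfect pseudomatching: one vertex of degree 2, all others of degree 1. -/
def IsPerfectPseudomatching {n : ℕ} (N : SimpleGraph (Fin n)) : Prop :=
  ∃ w, ((N.neighborSet w).ncard) = 2 ∧ ∀ v, v ≠ w → ((N.neighborSet v).ncard) = 1

/-- A set of edges forms a matching (no two distinct edges share a vertex). -/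
def IsMatchingSet {n : ℕ} (E : Set (Sym2 (Fin n))) : Prop :=
  ∀ e ∈ E, ∀ f ∈ E, e ≠ f → ∀ v : Fin n, v ∈ e → v ∉ f

/-- Number of cycles (orbits, including fixed points) of a permutation. -/
noncomputable def cycleCount {α : Type} (σ : Equiv.Perm α) : ℕ :=
  Nat.card (Quotient (⟨σ.SameCycle,
    ⟨fun x => Equiv.Perm.SameCycle.refl σ x, fun h => h.symm, fun h h' => h.trans h'⟩⟩ : Setoid α))

/-- Edges of the bipartite graph given by the relation `R` between `S` and `T`. -/
noncomputable def eBip {n : ℕ} (R : Fin n → Fin n → Prop) (S T : Set (Fin n)) : ℕ :=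
  {q : Fin n × Fin n | q.1 ∈ S ∧ q.2 ∈ T ∧ R q.1 q.2}.ncard

/-- One rotation of a path (represented as a list of vertices), with new edge from `H`
and pivot in `Q`. -/
def RotStep {V : Type} (H : SimpleGraph V) (Q : Set V) (l l' : List V) : Prop :=
  ∃ (x : V) (a : List V) (p : V) (b : List V),
    l = (x :: a) ++ p :: b ∧ l' = (x :: a).reverse ++ p :: b ∧ p ∈ Q ∧ H.Adj x p

/-- `v` is `(H, Q, τ)`-reachable from the path `l`. -/
def ReachableVert {V : Type} (H : SimpleGraph V) (Q : Set V) (τ : ℕ) (l : List V) (v : V) : Prop :=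
  ∃ (k : ℕ) (f : ℕ → List V), k ≤ τ ∧ f 0 = l ∧
    (∀ i < k, RotStep H Q (f i) (f (i + 1))) ∧ (f k).head? = some v

/-- External neighbourhood. -/
def extNbhd {V : Type} (H : SimpleGraph V) (S : Set V) : Set V :=
  (⋃ x ∈ S, H.neighborSet x) \ S


section PermanentLowerBound

open Polynomial

variable {α : Type} [Fintype α] [DecidableEq α]

/-- Maps that hit every point of `T` exactly once. -/
def hitsOnce (T : Finset α) : Finset (α → α) :=
  Finset.univ.filter fun φ => ∀ t ∈ T, (Finset.univ.filter fun i => φ i = t).card = 1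

/-- The mixed derivative `∂_T (∏ i, ∑ j, a i j * z j)` at `z_T = 0`. -/
noncomputable def mixedDeriv (a : α → α → ℝ) (T : Finset α) (z : α → ℂ) : ℂ :=
  ∑ φ ∈ hitsOnce T, ∏ i, ((a i (φ i) : ℂ) * if φ i ∈ T then 1 else z (φ i))

/-- `mixedDeriv` as a univariate polynomial in the coordinate `j`. -/
noncomputable def mixedDerivPoly (a : α → α → ℝ) (T : Finset α) (j : α) (z : α → ℂ) : ℂ[X] :=
  ∑ φ ∈ hitsOnce T, C (∏ i, ((a i (φ i) : ℂ) * if φ i ∈ insert j T then 1 else z (φ i))) *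
    X ^ (Finset.univ.filter fun i => φ i = j).card

theorem mixedDerivPoly_eval (a : α → α → ℝ) (T : Finset α) {j : α} (hj : j ∉ T) (z : α → ℂ)
    (t : ℂ) : (mixedDerivPoly a T j z).eval t = mixedDeriv a T (Function.update z j t) := by
  unfold mixedDerivPoly mixedDeriv
  rw [eval_finsetSum]
  refine Finset.sum_congr rfl fun φ _ => ?_
  have : t ^ (Finset.univ.filter fun i => φ i = j).card =
      ∏ i, if φ i = j then t else 1 := by
    rw [Finset.prod_ite, Finset.prod_const, Finset.prod_const_one, mul_one]
  rw [eval_mul, eval_C, eval_pow, eval_X, this, ← Finset.prod_mul_distrib]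
  refine Finset.prod_congr rfl fun i _ => ?_
  by_cases h : φ i = j
  · simp [h, hj]
  · simp [h]

theorem mixedDerivPoly_coeff_one (a : α → α → ℝ) (T : Finset α) {j : α} (z : α → ℂ) :
    (mixedDerivPoly a T j z).coeff 1 = mixedDeriv a (insert j T) z := by
  unfold mixedDerivPoly mixedDeriv
  rw [finsetSum_coeff]
  simp only [coeff_C_mul, coeff_X_pow, mul_ite, mul_one, mul_zero]
  rw [← Finset.sum_filter]
  refine Finset.sum_congr ?_ fun φ _ => rfl
  ext φ
  simp only [hitsOnce, Finset.mem_filter, Finset.mem_univ, true_and, Finset.mem_insert,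
    forall_eq_or_imp]
  constructor
  · rintro ⟨h1, h2⟩
    exact ⟨h2.symm, h1⟩
  · rintro ⟨h1, h2⟩
    exact ⟨h2, h1.symm⟩

theorem card_fiber_of_hitsOnce {T : Finset α} {φ : α → α} (hφ : φ ∈ hitsOnce T) :
    (Finset.univ.filter fun i => φ i ∉ T).card + T.card = Fintype.card α := by
  have h1 := Finset.sum_card_fiberwise_eq_card_filter (Finset.univ : Finset α) T φ
  have h2 : ∑ t ∈ T, (Finset.univ.filter fun i => φ i = t).card = T.card := by
    rw [Finset.card_eq_sum_ones]
    exact Finset.sum_congr rfl fun t ht => (Finset.mem_filter.1 hφ).2 t ht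
  rw [h2] at h1
  have h3 := Finset.card_filter_add_card_filter_not (s := (Finset.univ : Finset α)) (fun i => φ i ∈ T)
  rw [Finset.card_univ] at h3
  omega

theorem mixedDeriv_smul (a : α → α → ℝ) (T : Finset α) (z : α → ℂ) (u : ℂ) :
    mixedDeriv a T (fun i => u * z i) = u ^ (Fintype.card α - T.card) * mixedDeriv a T z := by
  unfold mixedDeriv
  rw [Finset.mul_sum]
  refine Finset.sum_congr rfl fun φ hφ => ?_
  have h : Fintype.card α - T.card = (Finset.univ.filter fun i => φ i ∉ T).card := by
    have := card_fiber_of_hitsOnce hφ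
    omega
  have : u ^ (Finset.univ.filter fun i => φ i ∉ T).card = ∏ i, if φ i ∉ T then u else 1 := by
    rw [Finset.prod_ite, Finset.prod_const, Finset.prod_const_one, mul_one]
  rw [h, this, ← Finset.prod_mul_distrib]
  refine Finset.prod_congr rfl fun i _ => ?_
  by_cases hi : φ i ∈ T <;> simp [hi]
  ring

theorem mixedDeriv_empty (a : α → α → ℝ) (z : α → ℂ) :
    mixedDeriv a ∅ z = ∏ i, ∑ j, (a i j : ℂ) * z j := by
  rw [Finset.prod_univ_sum, Fintype.piFinset_univ]
  simp [mixedDeriv, hitsOnce]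

theorem continuous_mixedDeriv (a : α → α → ℝ) (T : Finset α) : Continuous (mixedDeriv a T) := by
  unfold mixedDeriv
  refine continuous_finsetSum _ fun φ _ => continuous_finsetProd _ fun i _ => ?_
  split_ifs <;> fun_prop

theorem mixedDeriv_ne_zero {a : α → α → ℝ} (ha : ∀ i j, 0 < a i j) (T : Finset α) :
    ∀ z : α → ℂ, (∀ j ∉ T, 0 ≤ (z j).re) → (∃ j ∉ T, 0 < (z j).re) → mixedDeriv a T z ≠ 0 := by
  induction T using Finset.induction_on with
  | empty =>
    rintro z hz ⟨j, -, hj⟩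
    rw [mixedDeriv_empty, Finset.prod_ne_zero_iff]
    intro i _ h
    have h2 := congrArg Complex.re h
    rw [Complex.re_sum] at h2
    simp only [Complex.re_ofReal_mul, Complex.zero_re] at h2
    have : 0 < ∑ j, a i j * (z j).re :=
      Finset.sum_pos' (fun k _ => mul_nonneg (ha i k).le (hz k (by simp)))
        ⟨j, Finset.mem_univ _, mul_pos (ha i j) hj⟩
    linarith
  | insert j T hj ih =>
    rintro z hz ⟨k, hk, hkz⟩
    have hkj : k ≠ j := fun h => hk (by simp [h])
    have hkT : k ∉ T := fun h => hk (by simp [h])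
    set f := mixedDerivPoly a T j z with hf
    have hev : ∀ t : ℂ, 0 ≤ t.re → f.eval t ≠ 0 := by
      intro t ht
      rw [hf, mixedDerivPoly_eval a T hj]
      refine ih _ (fun i hi => ?_) ⟨k, hkT, by simpa [hkj] using hkz⟩
      by_cases hij : i = j
      · subst hij; simpa using ht
      · rw [Function.update_of_ne hij]; exact hz i (by simp [hij, hi])
    have h0 := hev 0 (by simp)
    have hld := (IsAlgClosed.splits f).eval_derivative_div_eval_of_ne_zero h0
    have hder : f.derivative.eval 0 = mixedDeriv a (insert j T) z := by
      rw [← mixedDerivPoly_coeff_one, ← hf, ← coeff_zero_eq_eval_zero, coeff_derivative]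
      simp
    rw [hder] at hld
    intro hzero
    rw [hzero, zero_div] at hld
    have hre : ∀ ρ ∈ f.roots, 0 < (1 / (0 - ρ)).re := by
      intro ρ hρ
      have h1 : f.eval ρ = 0 := (mem_roots'.1 hρ).2
      have h2 : ρ.re < 0 := by
        by_contra h
        exact hev ρ (not_lt.1 h) h1
      have h3 : ρ ≠ 0 := by rintro rfl; simp at h2
      rw [zero_sub, one_div, Complex.inv_re]
      exact div_pos (by simpa using h2) (Complex.normSq_pos.2 (neg_ne_zero.2 h3))
    have hroots : f.roots = 0 := by
      by_contra hne
      obtain ⟨ρ, hρ⟩ := Multiset.exists_mem_of_ne_zero hne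
      have hs : 0 < ((f.roots.map fun ρ => 1 / (0 - ρ)).map Complex.reLm).sum := by
        obtain ⟨s, hs⟩ := Multiset.exists_cons_of_mem hρ
        rw [hs, Multiset.map_cons, Multiset.map_cons, Multiset.sum_cons]
        refine add_pos_of_pos_of_nonneg (hre ρ hρ) (Multiset.sum_nonneg ?_)
        intro x hx
        simp only [Multiset.map_map, Multiset.mem_map] at hx
        obtain ⟨y, hy, rfl⟩ := hx
        exact (hre y (by rw [hs]; exact Multiset.mem_cons_of_mem hy)).le
      rw [← map_multiset_sum, ← hld] at hs
      simp at hs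
    have hconst : ∀ t, f.eval t = f.leadingCoeff := by
      intro t
      conv_lhs => rw [(IsAlgClosed.splits f).eq_prod_roots]
      simp [hroots]
    have hcard : Fintype.card α - T.card ≠ 0 := by
      have : T.card < (Finset.univ : Finset α).card :=
        Finset.card_lt_card ⟨Finset.subset_univ _, fun h => hj (h (Finset.mem_univ j))⟩
      rw [Finset.card_univ] at this
      omega
    have hlim : mixedDeriv a T (Function.update (fun _ => 0) j 1) = 0 := by
      let g : ℝ → α → ℂ := fun s => Function.update (fun i => (s : ℂ) * z i) j 1
      have hg : Continuous g := by
        apply Continuous.update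
        · fun_prop
        · fun_prop
      have hc : Continuous fun s => mixedDeriv a T (g s) := (continuous_mixedDeriv a T).comp hg
      have hc2 : Continuous fun s : ℝ => (s : ℂ) ^ (Fintype.card α - T.card) * f.leadingCoeff := by
        fun_prop
      have heq : Set.EqOn (fun s => mixedDeriv a T (g s))
          (fun s : ℝ => (s : ℂ) ^ (Fintype.card α - T.card) * f.leadingCoeff) {0}ᶜ := by
        intro s hs
        have hs' : (s : ℂ) ≠ 0 := by simpa using hs
        have : g s = fun i => (s : ℂ) * Function.update z j ((s : ℂ)⁻¹) i := by
          funext i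
          by_cases hij : i = j
          · subst hij; simp [g, hs']
          · simp [g, hij]
        simp only
        rw [this, mixedDeriv_smul, ← mixedDerivPoly_eval a T hj, ← hf, hconst]
      have hd : Dense ({0}ᶜ : Set ℝ) := dense_compl_singleton 0
      have := congrFun (Continuous.ext_on hd hc hc2 heq) 0
      simp only [g, Complex.ofReal_zero, zero_mul] at this
      rw [this, zero_pow hcard, zero_mul]
    refine ih (Function.update (fun _ => 0) j 1) (fun i _ => ?_) ⟨j, hj, by simp⟩ hlim
    by_cases hij : i = j
    · subst hij; simp
    · simp [hij]

theorem norm_mixedDeriv_ge {a : α → α → ℝ} (ha : ∀ i j, 0 < a i j) (hrow : ∀ i, ∑ j, a i j = 1)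
    (hcol : ∀ j, ∑ i, a i j = 1) (T : Finset α) (hT : T ≠ Finset.univ) :
    ∀ x : α → ℝ, (∀ j, 0 < x j) →
      Real.exp (-T.card) * ∏ j ∈ Finset.univ \ T, x j ≤ ‖mixedDeriv a T fun j => (x j : ℂ)‖ := by
  induction T using Finset.induction_on with
  | empty =>
    intro x hx
    rw [mixedDeriv_empty, norm_prod]
    simp only [Finset.card_empty, Nat.cast_zero, neg_zero, Real.exp_zero, one_mul,
      Finset.sdiff_empty]
    have h1 : ∀ i, ∏ j, x j ^ a i j ≤ ‖∑ j, (a i j : ℂ) * (x j : ℂ)‖ := by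
      intro i
      have h := Real.geom_mean_le_arith_mean_weighted Finset.univ (a i) x
        (fun j _ => (ha i j).le) (hrow i) (fun j _ => (hx j).le)
      refine h.trans ?_
      have : (∑ j, (a i j : ℂ) * (x j : ℂ)) = ((∑ j, a i j * x j : ℝ) : ℂ) := by push_cast; rfl
      rw [this, Complex.norm_real]
      exact le_abs_self _
    refine le_trans (le_of_eq ?_) (Finset.prod_le_prod (fun i _ =>
      Finset.prod_nonneg fun j _ => (Real.rpow_pos_of_pos (hx j) _).le) fun i _ => h1 i)
    rw [Finset.prod_comm]
    refine Finset.prod_congr rfl fun j _ => ?_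
    rw [← Real.rpow_sum_of_pos (hx j), hcol, Real.rpow_one]
  | insert j T hj ih =>
    intro x hx
    have hT' : T ≠ Finset.univ := fun h => hj (h ▸ Finset.mem_univ j)
    obtain ⟨k, hk⟩ : ∃ k, k ∉ insert j T := by
      by_contra! h
      exact hT (Finset.eq_univ_iff_forall.2 h)
    have hkj : k ≠ j := fun h => hk (by simp [h])
    have hkT : k ∉ T := fun h => hk (by simp [h])
    set z : α → ℂ := fun j => (x j : ℂ) with hz
    set f := mixedDerivPoly a T j z with hf
    set P := ∏ i ∈ Finset.univ \ insert j T, x i with hP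
    have hPpos : 0 < P := Finset.prod_pos fun i _ => hx i
    have hev : ∀ t : ℂ, 0 ≤ t.re → f.eval t ≠ 0 := by
      intro t ht
      rw [hf, mixedDerivPoly_eval a T hj]
      refine mixedDeriv_ne_zero ha T _ (fun i _ => ?_) ⟨k, hkT, by simpa [hkj, hz] using hx k⟩
      by_cases hij : i = j
      · subst hij; simpa using ht
      · rw [Function.update_of_ne hij]; simpa [hz] using (hx i).le
    have hroot : ∀ ρ ∈ f.roots, ρ.re < 0 ∧ ρ.im = 0 := by
      intro ρ hρ
      have h1 : f.eval ρ = 0 := (mem_roots'.1 hρ).2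
      have h2 : ρ.re < 0 := by
        by_contra h
        exact hev ρ (not_lt.1 h) h1
      refine ⟨h2, ?_⟩
      by_contra him
      rw [hf, mixedDerivPoly_eval a T hj] at h1
      let u : ℂ := ⟨ρ.im ^ 2, ρ.re * ρ.im⟩
      have hu : 0 < u.re := by
        show 0 < ρ.im ^ 2
        positivity
      refine mixedDeriv_ne_zero ha T (fun i => u * Function.update z j ρ i) (fun i _ => ?_)
        ⟨k, hkT, ?_⟩ (by rw [mixedDeriv_smul, h1, mul_zero])
      · by_cases hij : i = j
        · subst hij
          simp only [Function.update_self, Complex.mul_re, u]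
          apply le_of_eq
          ring
        · rw [Function.update_of_ne hij]
          simpa [hz] using mul_nonneg hu.le (hx i).le
      · rw [Function.update_of_ne hkj]
        simpa [hz] using mul_pos hu (hx k)
    have hroot' : ∀ ρ ∈ f.roots, ρ = -((-ρ.re : ℝ) : ℂ) := by
      intro ρ hρ
      apply Complex.ext <;> simp [(hroot ρ hρ).2]
    have h0 := hev 0 (by simp)
    have hld := (IsAlgClosed.splits f).eval_derivative_div_eval_of_ne_zero h0
    have hder : f.derivative.eval 0 = mixedDeriv a (insert j T) z := by
      rw [← mixedDerivPoly_coeff_one, ← hf, ← coeff_zero_eq_eval_zero, coeff_derivative]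
      simp
    rw [hder] at hld
    set s : ℝ := (f.roots.map fun ρ => 1 / (-ρ.re)).sum with hs
    have hs0 : 0 ≤ s := by
      refine Multiset.sum_nonneg fun y hy => ?_
      obtain ⟨ρ, hρ, rfl⟩ := Multiset.mem_map.1 hy
      exact one_div_nonneg.2 (by linarith [(hroot ρ hρ).1])
    have hsum : (f.roots.map fun ρ => 1 / (0 - ρ)).sum = (s : ℂ) := by
      rw [hs, ← Complex.ofRealHom_eq_coe, map_multiset_sum, Multiset.map_map]
      congr 1
      refine Multiset.map_congr rfl fun ρ hρ => ?_
      conv_lhs => rw [hroot' ρ hρ]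
      simp
    rw [hsum] at hld
    have hnorm : ‖mixedDeriv a (insert j T) z‖ = ‖f.eval 0‖ * s := by
      rw [div_eq_iff h0] at hld
      rw [hld, norm_mul, Complex.norm_real, Real.norm_of_nonneg hs0, mul_comm]
    have hgrow : ∀ t : ℝ, 0 < t → ‖f.eval (t : ℂ)‖ ≤ ‖f.eval 0‖ * Real.exp (t * s) := by
      intro t ht
      have key : ∀ m : Multiset ℂ, (∀ ρ ∈ m, ρ.re < 0 ∧ ρ.im = 0) →
          (m.map fun ρ => ‖(t : ℂ) - ρ‖).prod ≤ (m.map fun ρ => ‖(0 : ℂ) - ρ‖).prod *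
            Real.exp (t * (m.map fun ρ => 1 / (-ρ.re)).sum) := by
        intro m
        induction m using Multiset.induction_on with
        | empty => intro _; simp
        | cons ρ m ihm =>
          intro hm
          have h1 := ihm fun r hr => hm r (Multiset.mem_cons_of_mem hr)
          obtain ⟨h2, h3⟩ := hm ρ (Multiset.mem_cons_self ρ m)
          simp only [Multiset.map_cons, Multiset.prod_cons, Multiset.sum_cons]
          have e1 : ‖(t : ℂ) - ρ‖ = t + -ρ.re := by
            have : (t : ℂ) - ρ = ((t + -ρ.re : ℝ) : ℂ) := by apply Complex.ext <;> simp [h3]; ring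
            rw [this, Complex.norm_real, Real.norm_of_nonneg (by linarith)]
          have e2 : ‖(0 : ℂ) - ρ‖ = -ρ.re := by
            have : (0 : ℂ) - ρ = ((-ρ.re : ℝ) : ℂ) := by apply Complex.ext <;> simp [h3]
            rw [this, Complex.norm_real, Real.norm_of_nonneg (by linarith)]
          have e3 : t + -ρ.re ≤ (-ρ.re) * Real.exp (t * (1 / (-ρ.re))) := by
            have := Real.add_one_le_exp (t * (1 / (-ρ.re)))
            have h4 : 0 < -ρ.re := by linarith
            generalize -ρ.re = c at this h4 ⊢
            calc t + c = c * (t * (1 / c) + 1) := by field_simp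
              _ ≤ _ := by gcongr
          rw [e1, e2, mul_add, Real.exp_add]
          calc (t + -ρ.re) * (m.map fun ρ => ‖(t : ℂ) - ρ‖).prod
              ≤ ((-ρ.re) * Real.exp (t * (1 / (-ρ.re)))) *
                ((m.map fun ρ => ‖(0 : ℂ) - ρ‖).prod *
                  Real.exp (t * (m.map fun ρ => 1 / (-ρ.re)).sum)) := by
                refine mul_le_mul e3 h1 ?_ ?_
                · exact Multiset.prod_nonneg fun y hy => by
                    obtain ⟨r, -, rfl⟩ := Multiset.mem_map.1 hy
                    exact norm_nonneg _
                · exact mul_nonneg (by linarith) (Real.exp_pos _).le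
            _ = _ := by ring
      have hfe : ∀ t : ℂ, ‖f.eval t‖ = ‖f.leadingCoeff‖ * (f.roots.map fun ρ => ‖t - ρ‖).prod := by
        intro t
        conv_lhs => rw [(IsAlgClosed.splits f).eq_prod_roots]
        rw [eval_mul, eval_C, norm_mul, eval_multiset_prod, Multiset.map_map]
        congr 1
        have : ∀ m : Multiset ℂ, ‖m.prod‖ = (m.map fun r => ‖r‖).prod := fun m =>
          map_multiset_prod (normHom : ℂ →*₀ ℝ) m
        rw [this, Multiset.map_map]
        simp
      rw [hfe, hfe, mul_assoc]
      exact mul_le_mul_of_nonneg_left (key _ hroot) (norm_nonneg _)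
    have hlow : ∀ t : ℝ, 0 < t → Real.exp (-T.card) * (t * P) ≤ ‖f.eval (t : ℂ)‖ := by
      intro t ht
      have h := ih hT' (Function.update x j t) fun i => by
        by_cases hij : i = j
        · subst hij; simpa using ht
        · rw [Function.update_of_ne hij]; exact hx i
      have e1 : (fun i => ((Function.update x j t i : ℝ) : ℂ)) = Function.update z j (t : ℂ) := by
        funext i
        by_cases hij : i = j
        · subst hij; simp
        · simp [hij, hz]
      have e2 : ∏ i ∈ Finset.univ \ T, Function.update x j t i = t * P := by
        have : Finset.univ \ T = insert j (Finset.univ \ insert j T) := by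
          ext i
          by_cases hij : i = j
          · subst hij; simp [hj]
          · simp [hij]
        rw [this, Finset.prod_insert (by simp), Function.update_self, hP]
        congr 1
        refine Finset.prod_congr rfl fun i hi => ?_
        rw [Function.update_of_ne]
        rintro rfl
        simp at hi
      rwa [e1, e2, ← mixedDerivPoly_eval a T hj, ← hf] at h
    have hc : 0 < Real.exp (-T.card) * P := by positivity
    rcases hs0.eq_or_lt with h | h
    · exfalso
      have h1 : 0 < (‖f.eval 0‖ + 1) / (Real.exp (-T.card) * P) := by positivity
      have h2 := (hlow _ h1).trans (hgrow _ h1)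
      rw [← h, mul_zero, Real.exp_zero, mul_one] at h2
      have h3 : Real.exp (-T.card) * ((‖f.eval 0‖ + 1) / (Real.exp (-T.card) * P) * P) =
          ‖f.eval 0‖ + 1 := by field_simp
      linarith
    · have h1 := (hlow (1 / s) (by positivity)).trans (hgrow (1 / s) (by positivity))
      rw [one_div_mul_cancel h.ne'] at h1
      rw [hnorm, Finset.card_insert_of_notMem hj, Nat.cast_add, Nat.cast_one, neg_add,
        Real.exp_add, Real.exp_neg 1]
      calc Real.exp (-T.card) * (Real.exp 1)⁻¹ * P
          = Real.exp (-T.card) * (1 / s * P) * (s * (Real.exp 1)⁻¹) := by field_simp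
        _ ≤ ‖f.eval 0‖ * Real.exp 1 * (s * (Real.exp 1)⁻¹) := by gcongr
        _ = _ := by field_simp

theorem exp_neg_card_le_sum_perm {a : α → α → ℝ} (ha : ∀ i j, 0 < a i j)
    (hrow : ∀ i, ∑ j, a i j = 1) (hcol : ∀ j, ∑ i, a i j = 1) :
    Real.exp (-(Fintype.card α : ℝ)) ≤ ∑ σ : Equiv.Perm α, ∏ i, a i (σ i) := by
  rcases isEmpty_or_nonempty α with hα | ⟨⟨j⟩⟩
  · simp
  have hcard : (Finset.univ.erase j).card + 1 = Fintype.card α := by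
    rw [Finset.card_erase_add_one (Finset.mem_univ j), Finset.card_univ]
  have h := norm_mixedDeriv_ge ha hrow hcol (Finset.univ.erase j)
    (fun h => absurd (h.symm.subset (Finset.mem_univ j)) (Finset.notMem_erase j Finset.univ)) (fun _ => 1) fun _ => one_pos
  simp only [Finset.prod_const_one, mul_one] at h
  have h1 : ‖mixedDeriv a (Finset.univ.erase j) fun _ => ((1 : ℝ) : ℂ)‖ =
      ∑ σ : Equiv.Perm α, ∏ i, a i (σ i) := by
    have e : (mixedDeriv a (Finset.univ.erase j) fun _ => ((1 : ℝ) : ℂ)) =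
        ((∑ σ : Equiv.Perm α, ∏ i, a i (σ i) : ℝ) : ℂ) := by
      unfold mixedDeriv
      push_cast
      symm
      refine Finset.sum_bij (fun σ _ => ⇑σ) (fun σ _ => ?_) (fun σ _ τ _ h => DFunLike.coe_injective h)
        (fun φ hφ => ?_) (fun σ _ => ?_)
      · rw [hitsOnce, Finset.mem_filter]
        refine ⟨Finset.mem_univ _, fun t _ => Finset.card_eq_one.2 ⟨σ.symm t, ?_⟩⟩
        ext i
        simp [Equiv.eq_symm_apply]
      · have h1 := card_fiber_of_hitsOnce hφ
        have h2 : (Finset.univ.filter fun i => φ i ∉ Finset.univ.erase j) =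
          Finset.univ.filter fun i => φ i = j := by
          ext i; simp
        rw [h2] at h1
        have h3 : ∀ t, (Finset.univ.filter fun i => φ i = t).card = 1 := by
          intro t
          by_cases htj : t = j
          · subst htj; omega
          · exact (Finset.mem_filter.1 hφ).2 t (by simp [htj])
        have hsurj : Function.Surjective φ := by
          intro t
          obtain ⟨i, hi⟩ := Finset.card_pos.1 ((h3 t).symm ▸ one_pos)
          exact ⟨i, (Finset.mem_filter.1 hi).2⟩
        exact ⟨Equiv.ofBijective φ (Finite.injective_iff_bijective.1
          (Finite.injective_iff_surjective.2 hsurj)), Finset.mem_univ _, rfl⟩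
      · refine Finset.prod_congr rfl fun i _ => ?_
        split_ifs <;> simp
    rw [e, Complex.norm_real, Real.norm_of_nonneg]
    exact Finset.sum_nonneg fun σ _ => Finset.prod_nonneg fun i _ => (ha _ _).le
  rw [h1] at h
  refine le_trans (Real.exp_le_exp.2 ?_) h
  rw [neg_le_neg_iff]
  exact_mod_cast (by omega : (Finset.univ.erase j).card ≤ Fintype.card α)

/-- A `d`-regular relation on `n` points contains at least `(d / e) ^ n` permutations. -/
theorem regular_card_perm_ge {R : α → α → Prop} {d : ℕ} (hd : 1 ≤ d)
    (hout : ∀ i, (Finset.univ.filter fun j => R i j).card = d)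
    (hin : ∀ j, (Finset.univ.filter fun i => R i j).card = d) :
    (d / Real.exp 1) ^ Fintype.card α ≤
      ((Finset.univ.filter fun σ : Equiv.Perm α => ∀ i, R i (σ i)).card : ℝ) := by
  rcases isEmpty_or_nonempty α with hα | hα
  · simp
  have hn : (0 : ℝ) < Fintype.card α := by exact_mod_cast Fintype.card_pos
  have hd' : (0 : ℝ) < d := by exact_mod_cast hd
  let b : ℝ → α → α → ℝ := fun ε i j =>
    (1 - ε) * ((if R i j then 1 else 0) / d) + ε / Fintype.card α
  have hsum : ∀ ε : ℝ, ∀ s : α → Prop, (Finset.univ.filter s).card = d →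
      ∑ j, ((1 - ε) * ((if s j then 1 else 0) / d) + ε / Fintype.card α) = 1 := by
    intro ε s hs
    rw [Finset.sum_add_distrib, ← Finset.mul_sum, ← Finset.sum_div, Finset.sum_boole, hs,
      Finset.sum_const, Finset.card_univ, nsmul_eq_mul]
    field_simp
    ring
  let F : ℝ → ℝ := fun ε => ∑ σ : Equiv.Perm α, ∏ i, b ε i (σ i)
  have hF : Continuous F := by
    refine continuous_finsetSum _ fun σ _ => continuous_finsetProd _ fun i _ => ?_
    simp only [b]
    fun_prop
  have hlow : ∀ ε ∈ Set.Ioo (0 : ℝ) 1, Real.exp (-(Fintype.card α : ℝ)) ≤ F ε := by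
    rintro ε ⟨h0, h1⟩
    refine exp_neg_card_le_sum_perm (fun i j => ?_) (fun i => hsum ε (fun j => R i j) (hout i))
      (fun j => hsum ε (fun i => R i j) (hin j))
    refine add_pos_of_nonneg_of_pos (mul_nonneg (by linarith) ?_) (by positivity)
    split_ifs <;> positivity
  have h0 : Real.exp (-(Fintype.card α : ℝ)) ≤ F 0 := by
    have hmem : (0 : ℝ) ∈ closure (Set.Ioo (0 : ℝ) 1) := by
      rw [closure_Ioo zero_ne_one]; simp
    exact closure_minimal (s := Set.Ioo (0 : ℝ) 1)
      (t := {ε | Real.exp (-(Fintype.card α : ℝ)) ≤ F ε}) hlow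
      (isClosed_le continuous_const hF) hmem
  have hF0 : F 0 = ((Finset.univ.filter fun σ : Equiv.Perm α => ∀ i, R i (σ i)).card : ℝ) /
      d ^ Fintype.card α := by
    simp only [F, b, sub_zero, one_mul, zero_div, add_zero]
    rw [Finset.card_filter, Nat.cast_sum, Finset.sum_div]
    refine Finset.sum_congr rfl fun σ _ => ?_
    rw [Finset.prod_div_distrib, Finset.prod_const, Finset.card_univ]
    congr 1
    rw [Finset.prod_ite_zero]
    simp
  rw [hF0, le_div_iff₀ (by positivity)] at h0
  refine le_trans (le_of_eq ?_) h0
  rw [div_pow, ← Real.exp_nat_mul, mul_one, Real.exp_neg]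
  field_simp

end PermanentLowerBound

section WeightedBregman

open Finset

variable {α : Type} [Fintype α] [DecidableEq α]

/-- Permutations of `S` along `R` (extended by the identity) together with an invariant
two-colouring of `S` (extended by `false`). -/
noncomputable def colouredPerms (S : Finset α) (R : α → α → Prop) :
    Finset (Equiv.Perm α × (α → Bool)) :=
  univ.filter fun x => (∀ v ∉ S, x.1 v = v ∧ x.2 v = false) ∧
    ∀ v ∈ S, R v (x.1 v) ∧ x.2 (x.1 v) = x.2 v

theorem mem_colouredPerms {S : Finset α} {R : α → α → Prop} {x : Equiv.Perm α × (α → Bool)} :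
    x ∈ colouredPerms S R ↔ (∀ v ∉ S, x.1 v = v ∧ x.2 v = false) ∧
      ∀ v ∈ S, R v (x.1 v) ∧ x.2 (x.1 v) = x.2 v := by
  simp [colouredPerms]

theorem perm_mem_of_mem {α : Type} {S : Finset α} {σ : Equiv.Perm α} (h : ∀ v ∉ S, σ v = v) {i : α}
    (hi : i ∈ S) : σ i ∈ S := by
  by_contra hc
  have := σ.injective (h _ hc)
  exact hc (this.symm ▸ hi)

/-- Average logarithmic contribution of a row with `r` allowed positions. -/
noncomputable def rowBound (r : ℕ) : ℝ := Real.log ((r + 1).factorial) / r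

theorem rowBound_nonneg (r : ℕ) : 0 ≤ rowBound r :=
  div_nonneg (Real.log_nonneg (by exact_mod_cast Nat.factorial_pos _)) (Nat.cast_nonneg _)

theorem mul_rowBound {r : ℕ} (hr : 1 ≤ r) : r * rowBound r = Real.log ((r + 1).factorial) := by
  have : (r : ℝ) ≠ 0 := by positivity
  unfold rowBound
  field_simp

theorem pred_mul_rowBound {r : ℕ} (hr : 1 ≤ r) :
    ((r : ℝ) - 1) * rowBound (r - 1) = Real.log (r.factorial) := by
  obtain ⟨k, rfl⟩ : ∃ k, r = k + 1 := ⟨r - 1, by omega⟩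
  rcases Nat.eq_zero_or_pos k with rfl | hk
  · simp
  · have := mul_rowBound hk
    simpa using this

/-- Fixing the image `w` of `i` leaves a smaller instance with the columns `i`, `w` swapped. -/
theorem card_colouredPerms_fiber_le (S : Finset α) (R : α → α → Prop) {i w : α} (hi : i ∈ S) :
    ((colouredPerms S R).filter fun x => x.1 i = w).card ≤
      (if w = i then 2 else 1) *
        (colouredPerms (S.erase i) fun v b => R v (Equiv.swap i w b)).card := by
  have hc : (if w = i then 2 else 1) = (if w = i then univ else {false} : Finset Bool).card := by
    split_ifs <;> simp
  rw [hc, mul_comm, ← card_product]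
  refine card_le_card_of_injOn (fun x => ((Equiv.swap i w * x.1, Function.update x.2 i false),
    if w = i then x.2 i else false)) ?_ ?_
  · rintro ⟨σ, f⟩ hx
    rw [mem_coe, mem_filter, mem_colouredPerms] at hx
    obtain ⟨⟨h1, h2⟩, h3⟩ := hx
    dsimp only at h1 h2 h3
    have hw : w ∈ S := h3 ▸ perm_mem_of_mem (fun v hv => (h1 v hv).1) hi
    rw [mem_coe, mem_product]
    refine ⟨?_, by dsimp only; split_ifs <;> simp⟩
    rw [mem_colouredPerms]
    dsimp only
    refine ⟨fun v hv => ?_, fun v hv => ?_⟩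
    · rw [mem_erase, not_and] at hv
      by_cases hvi : v = i
      · subst hvi; simp [h3]
      · have hvS := hv hvi
        have hvw : v ≠ w := fun h => hvS (h ▸ hw)
        simp [(h1 v hvS).1, (h1 v hvS).2, hvi, Equiv.swap_apply_of_ne_of_ne hvi hvw]
    · rw [mem_erase] at hv
      obtain ⟨hvi, hvS⟩ := hv
      have hne : σ v ≠ w := fun h => hvi (σ.injective (h.trans h3.symm))
      refine ⟨by simpa using (h2 v hvS).1, ?_⟩
      rw [Equiv.Perm.mul_apply, Function.update_of_ne hvi]
      by_cases hsi : σ v = i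
      · have hwi : w ≠ i := fun h => hne (hsi.trans h.symm)
        rw [hsi, Equiv.swap_apply_left, Function.update_of_ne hwi, ← h3, (h2 i hi).2,
          ← (h2 v hvS).2, hsi]
      · rw [Equiv.swap_apply_of_ne_of_ne hsi hne, Function.update_of_ne hsi, (h2 v hvS).2]
  · rintro ⟨σ, f⟩ hx ⟨τ, g⟩ hy h
    rw [mem_coe, mem_filter, mem_colouredPerms] at hx hy
    obtain ⟨⟨-, h2⟩, h3⟩ := hx
    obtain ⟨⟨-, h2'⟩, h3'⟩ := hy
    dsimp only at h2 h3 h2' h3'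
    simp only [Prod.mk.injEq, mul_right_inj] at h
    obtain ⟨⟨rfl, hf⟩, hb⟩ := h
    refine Prod.ext rfl (funext fun v => ?_)
    have key : ∀ u, u ≠ i → f u = g u := fun u hu => by
      simpa [hu] using congrFun hf u
    dsimp only
    by_cases hv : v = i
    · subst hv
      by_cases hwv : w = v
      · simpa [hwv] using hb
      · rw [← (h2 v hi).2, ← (h2' v hi).2, h3]; exact key w hwv
    · exact key v hv

theorem card_filter_swap {α : Type} [DecidableEq α] (S : Finset α) (Q : α → Prop) {i w : α} (hi : i ∈ S) (hw : w ∈ S) :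
    ((S.erase i).filter fun b => Q (Equiv.swap i w b)).card =
      (S.filter Q).card - if Q w then 1 else 0 := by
  have h1 : ((S.erase i).filter fun b => Q (Equiv.swap i w b)).card =
      ((S.erase w).filter Q).card := by
    refine card_bij (fun b _ => Equiv.swap i w b) (fun b hb => ?_)
      (fun a _ b _ h => (Equiv.swap i w).injective h) (fun b hb => ⟨Equiv.swap i w b, ?_, by simp⟩)
    · rw [mem_filter, mem_erase] at hb ⊢
      refine ⟨⟨fun h => hb.1.1 ?_, ?_⟩, hb.2⟩
      · rw [Equiv.swap_apply_eq_iff, Equiv.swap_apply_right] at h; exact h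
      · rcases eq_or_ne b w with rfl | hbw
        · simpa using hi
        · rw [Equiv.swap_apply_of_ne_of_ne hb.1.1 hbw]; exact hb.1.2
    · rw [mem_filter, mem_erase] at hb ⊢
      refine ⟨⟨fun h => hb.1.1 ?_, ?_⟩, by simpa using hb.2⟩
      · rw [Equiv.swap_apply_eq_iff, Equiv.swap_apply_left] at h; exact h
      · rcases eq_or_ne b i with rfl | hbw
        · simpa using hw
        · rw [Equiv.swap_apply_of_ne_of_ne hbw hb.1.1]; exact hb.1.2
  rw [h1, filter_erase]
  split_ifs with h
  · rw [card_erase_of_mem (by simp [h, hw])]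
  · rw [erase_eq_of_notMem (by simp [h])]; simp

theorem mul_log_le_of_sum_eq {ι : Type} (T : Finset ι) (P c W : ι → ℝ) {Z : ℝ} {C : ℝ}
    (hP : ∀ w ∈ T, 0 ≤ P w) (hc : ∀ w ∈ T, 0 < c w) (hPW : ∀ w ∈ T, P w ≤ c w * W w)
    (hZ : 0 < Z) (hsum : ∑ w ∈ T, P w = Z) (hC : ∑ w ∈ T, c w ≤ C) (hC0 : 0 < C) :
    Z * Real.log Z ≤ Z * Real.log C + ∑ w ∈ T, P w * Real.log (W w) := by
  have key : ∀ w ∈ T, P w * Real.log Z ≤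
      P w * Real.log C + P w * Real.log (W w) + (Z * c w / C - P w) := by
    intro w hw
    have hcw := hc w hw
    rcases (hP w hw).eq_or_lt with h | h
    · rw [← h]; simp; positivity
    have hW : 0 < W w := pos_of_mul_pos_right (h.trans_le (hPW w hw)) hcw.le
    have h1 := Real.log_le_sub_one_of_pos (x := Z * c w / (C * P w)) (by positivity)
    rw [Real.log_div (by positivity) (by positivity), Real.log_mul hZ.ne' hcw.ne',
      Real.log_mul hC0.ne' h.ne'] at h1
    have h2 : Real.log (P w) ≤ Real.log (c w) + Real.log (W w) := by
      rw [← Real.log_mul hcw.ne' hW.ne']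
      exact Real.log_le_log h (hPW w hw)
    have h3 : P w * (Z * c w / (C * P w) - 1) = Z * c w / C - P w := by field_simp
    have h4 : P w * Real.log Z ≤ P w * (Real.log C + Real.log (W w) +
        (Z * c w / (C * P w) - 1)) := by
      gcongr; linarith
    linarith [h3, h4]
  calc Z * Real.log Z = ∑ w ∈ T, P w * Real.log Z := by rw [← sum_mul, hsum]
    _ ≤ ∑ w ∈ T, (P w * Real.log C + P w * Real.log (W w) + (Z * c w / C - P w)) :=
        sum_le_sum key
    _ = Z * Real.log C + (∑ w ∈ T, P w * Real.log (W w)) + (Z * (∑ w ∈ T, c w) / C - Z) := by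
        rw [sum_add_distrib, sum_add_distrib, sum_sub_distrib, ← sum_mul, hsum, ← sum_div,
          ← mul_sum]
    _ ≤ _ := by
        have : Z * (∑ w ∈ T, c w) / C ≤ Z := by
          rw [div_le_iff₀ hC0]; gcongr
        linarith

theorem sum_rowBound_shift {α : Type} [DecidableEq α] (S : Finset α) (R : α → α → Prop)
    {σ : Equiv.Perm α} (hσ : ∀ v ∉ S, σ v = v) (hR : ∀ v ∈ S, R v (σ v)) {v : α} (hv : v ∈ S) :
    ∑ i ∈ S.erase v, rowBound ((S.filter (R v)).card - if R v (σ i) then 1 else 0) =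
      S.card * rowBound (S.filter (R v)).card - Real.log ((S.filter (R v)).card + 1) := by
  set r := (S.filter (R v)).card with hr
  have hr1 : 1 ≤ r := card_pos.2 ⟨σ v, by
    rw [mem_filter]; exact ⟨perm_mem_of_mem hσ hv, hR v hv⟩⟩
  have hcount : ((S.erase v).filter fun i => R v (σ i)).card = r - 1 := by
    rw [filter_erase, card_erase_of_mem (by simp [hv, hR v hv]), hr]
    congr 1
    refine card_bij (fun b _ => σ b) (fun b hb => ?_) (fun a _ b _ h => σ.injective h)
      (fun b hb => ⟨σ.symm b, ?_, by simp⟩)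
    · rw [mem_filter] at hb ⊢
      exact ⟨perm_mem_of_mem hσ hb.1, hb.2⟩
    · rw [mem_filter] at hb ⊢
      refine ⟨perm_mem_of_mem (σ := σ.symm) (fun u hu => ?_) hb.1, by simpa using hb.2⟩
      rw [Equiv.symm_apply_eq, hσ u hu]
  have hcount2 : (((S.erase v).filter fun i => ¬ R v (σ i)).card : ℝ) = S.card - r := by
    have h1 := card_filter_add_card_filter_not (s := S.erase v) (fun i => R v (σ i))
    rw [hcount] at h1
    have h2 := card_erase_add_one hv
    have h3 : ((S.erase v).filter fun i => ¬ R v (σ i)).card + r = S.card := by omega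
    rw [← h3]; push_cast; ring
  rw [← sum_filter_add_sum_filter_not (S.erase v) (fun i => R v (σ i))]
  rw [sum_congr rfl (g := fun _ => rowBound (r - 1)) (fun i hi => by
      rw [if_pos (mem_filter.1 hi).2]),
    sum_congr (s₁ := (S.erase v).filter fun i => ¬ R v (σ i)) rfl
      (g := fun _ => rowBound r) (fun i hi => by
      rw [if_neg (mem_filter.1 hi).2, Nat.sub_zero]), sum_const, sum_const, hcount,
      nsmul_eq_mul, nsmul_eq_mul, hcount2, Nat.cast_sub hr1, Nat.cast_one, pred_mul_rowBound hr1,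
      sub_mul, mul_rowBound hr1, Nat.factorial_succ, Nat.cast_mul,
      Real.log_mul (by positivity) (by positivity)]
  push_cast
  ring

theorem log_card_colouredPerms_le (S : Finset α) (R : α → α → Prop) :
    Real.log ((colouredPerms S R).card) ≤ ∑ v ∈ S, rowBound (S.filter (R v)).card := by
  induction hs : S.card generalizing S R with
  | zero =>
    rw [card_eq_zero] at hs
    subst hs
    have : (colouredPerms ∅ R).card ≤ 1 := by
      rw [card_le_one]
      rintro ⟨σ, f⟩ hx ⟨τ, g⟩ hy
      rw [mem_colouredPerms] at hx hy
      refine Prod.ext (Equiv.ext fun v => ?_) (funext fun v => ?_)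
      · exact (hx.1 v (by simp)).1.trans (hy.1 v (by simp)).1.symm
      · exact (hx.1 v (by simp)).2.trans (hy.1 v (by simp)).2.symm
    rw [sum_empty]
    exact Real.log_nonpos (by positivity) (by exact_mod_cast this)
  | succ s ih =>
    rcases Nat.eq_zero_or_pos (colouredPerms S R).card with h0 | hpos
    · rw [h0]; simpa using sum_nonneg fun v _ => rowBound_nonneg _
    set Z : ℝ := ((colouredPerms S R).card : ℝ) with hZ
    have hZ0 : 0 < Z := by rw [hZ]; exact_mod_cast hpos
    have step : ∀ i ∈ S, Z * Real.log Z ≤ Z * Real.log ((S.filter (R i)).card + 1) +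
        ∑ x ∈ colouredPerms S R, ∑ v ∈ S.erase i,
          rowBound ((S.filter (R v)).card - if R v (x.1 i) then 1 else 0) := by
      intro i hi
      have hmaps : ∀ x ∈ colouredPerms S R, x.1 i ∈ S.filter (R i) := by
        intro x hx
        rw [mem_colouredPerms] at hx
        rw [mem_filter]
        exact ⟨perm_mem_of_mem (fun v hv => (hx.1 v hv).1) hi, (hx.2 i hi).1⟩
      have h1 := mul_log_le_of_sum_eq (S.filter (R i))
        (fun w => (((colouredPerms S R).filter fun x => x.1 i = w).card : ℝ))
        (fun w => if w = i then 2 else 1)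
        (fun w => ((colouredPerms (S.erase i) fun v b => R v (Equiv.swap i w b)).card : ℝ))
        (Z := Z) (C := (S.filter (R i)).card + 1) (fun w _ => by positivity)
        (fun w _ => by split_ifs <;> norm_num)
        (fun w _ => by
          have := card_colouredPerms_fiber_le S R (w := w) hi
          have h2 : (((colouredPerms S R).filter fun x => x.1 i = w).card : ℝ) ≤
            (((if w = i then 2 else 1) * (colouredPerms (S.erase i)
              fun v b => R v (Equiv.swap i w b)).card : ℕ) : ℝ) := by exact_mod_cast this
          refine h2.trans (le_of_eq ?_)
          push_cast
          rfl)
        hZ0 (by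
          rw [hZ, card_eq_sum_card_fiberwise hmaps]; push_cast; rfl)
        (by
          have : ∀ w, (if w = i then (2 : ℝ) else 1) = 1 + if w = i then 1 else 0 := by
            intro w; split_ifs <;> norm_num
          simp only [this, sum_add_distrib, sum_const, nsmul_eq_mul, mul_one, sum_ite_eq']
          gcongr
          split_ifs <;> norm_num)
        (by positivity)
      refine h1.trans ?_
      gcongr
      rw [← sum_fiberwise_of_maps_to hmaps]
      refine sum_le_sum fun w hw => ?_
      rw [sum_congr rfl (g := fun _ => ∑ v ∈ S.erase i,
        rowBound ((S.filter (R v)).card - if R v w then 1 else 0)) (fun x hx => by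
          rw [(mem_filter.1 hx).2]), sum_const, nsmul_eq_mul]
      gcongr
      refine (ih (S.erase i) _ (by rw [card_erase_of_mem hi, hs]; rfl)).trans (le_of_eq ?_)
      refine sum_congr rfl fun v _ => ?_
      congr 1
      exact card_filter_swap S (R v) hi (mem_filter.1 hw).1
    have hsum := sum_le_sum step
    rw [sum_const, nsmul_eq_mul, sum_add_distrib, sum_comm] at hsum
    have hin : ∀ x ∈ colouredPerms S R, ∑ i ∈ S, ∑ v ∈ S.erase i,
        rowBound ((S.filter (R v)).card - if R v (x.1 i) then 1 else 0) =
        ∑ v ∈ S, (S.card * rowBound (S.filter (R v)).card -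
          Real.log ((S.filter (R v)).card + 1)) := by
      intro x hx
      rw [mem_colouredPerms] at hx
      rw [sum_comm' (t' := S) (s' := fun v => S.erase v) (fun i v => by
        simp only [mem_erase]; tauto)]
      exact sum_congr rfl fun v hv =>
        sum_rowBound_shift S R (fun v hv => (hx.1 v hv).1) (fun v hv => (hx.2 v hv).1) hv
    rw [sum_congr rfl hin, sum_const, nsmul_eq_mul, sum_sub_distrib, ← mul_sum, ← mul_sum,
      ← hZ] at hsum
    have hs0 : (0 : ℝ) < S.card * Z := by
      rw [hs]; positivity
    refine le_of_mul_le_mul_left ?_ hs0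
    linarith

end WeightedBregman

section FewCyclesPermutation

open Finset

variable {α : Type} [Fintype α] [DecidableEq α]

/-- Two-colourings that are constant on the cycles of `σ`. -/
noncomputable def invColourings (σ : Equiv.Perm α) : Finset (α → Bool) :=
  univ.filter fun f => ∀ v, f (σ v) = f v

theorem log_factorial_le {d : ℕ} (hd : 1 ≤ d) :
    Real.log d.factorial ≤ d * Real.log d - d + Real.log d + 1 := by
  induction d, hd using Nat.le_induction with
  | base => simp
  | succ k hk ih =>
    have hk0 : (0 : ℝ) < k := by exact_mod_cast hk
    have h1 := Real.one_sub_inv_le_log_of_pos (x := ((k : ℝ) + 1) / k) (by positivity)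
    rw [Real.log_div (by positivity) hk0.ne', inv_div] at h1
    have h2 : 1 - (k : ℝ) / (k + 1) = 1 / (k + 1) := by field_simp; ring
    rw [h2] at h1
    have h3 : ((k : ℝ) + 1) * (1 / (k + 1)) ≤ (k + 1) * (Real.log (k + 1) - Real.log k) := by
      gcongr
    rw [mul_one_div_cancel (by positivity)] at h3
    rw [Nat.factorial_succ, Nat.cast_mul, Real.log_mul (by positivity) (by positivity)]
    push_cast
    linarith

/-- A regular relation contains a permutation with few cycles. -/
theorem exists_perm_log_invColourings_le {R : α → α → Prop} {d : ℕ} (hd : 1 ≤ d)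
    (hout : ∀ i, (univ.filter fun j => R i j).card = d)
    (hin : ∀ j, (univ.filter fun i => R i j).card = d) :
    ∃ σ : Equiv.Perm α, (∀ v, R v (σ v)) ∧
      Real.log ((invColourings σ).card) ≤
        Fintype.card α / d * (2 * Real.log (d + 1) + 1) := by
  by_contra! hcon
  set B := (Fintype.card α : ℝ) / d * (2 * Real.log (d + 1) + 1) with hB
  have hd0 : (0 : ℝ) < d := by exact_mod_cast hd
  set Q := univ.filter fun σ : Equiv.Perm α => ∀ i, R i (σ i) with hQ
  have hper : (d / Real.exp 1) ^ Fintype.card α ≤ (Q.card : ℝ) := regular_card_perm_ge hd hout hin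
  have hQ0 : (0 : ℝ) < Q.card := lt_of_lt_of_le (by positivity) hper
  have hcard : ((colouredPerms univ R).card : ℝ) = ∑ σ ∈ Q, ((invColourings σ).card : ℝ) := by
    rw [← Nat.cast_sum]
    norm_cast
    rw [← card_sigma]
    refine card_bij (fun x _ => ⟨x.1, x.2⟩) (fun x hx => ?_) (fun x _ y _ h => ?_)
      (fun x hx => ⟨(x.1, x.2), ?_, rfl⟩)
    · rw [mem_colouredPerms] at hx
      simp only [mem_sigma, hQ, mem_filter, mem_univ, true_and, invColourings]
      exact ⟨fun i => (hx.2 i (mem_univ i)).1, fun i => (hx.2 i (mem_univ i)).2⟩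
    · simp only [Sigma.mk.injEq, heq_eq_eq] at h
      exact Prod.ext h.1 h.2
    · simp only [mem_sigma, hQ, mem_filter, mem_univ, true_and, invColourings] at hx
      rw [mem_colouredPerms]
      exact ⟨by simp, fun v _ => ⟨hx.1 v, hx.2 v⟩⟩
  have hlt : Real.exp B * Q.card < (colouredPerms univ R).card := by
    rw [hcard, mul_comm, ← nsmul_eq_mul, ← sum_const]
    refine sum_lt_sum_of_nonempty (card_pos.1 (by exact_mod_cast hQ0)) fun σ hσ => ?_
    have hpos : (0 : ℝ) < (invColourings σ).card := by
      have : (fun _ => false) ∈ invColourings σ := by simp [invColourings]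
      exact_mod_cast card_pos.2 ⟨_, this⟩
    rw [← Real.lt_log_iff_exp_lt hpos]
    exact hcon σ (by simpa [hQ] using hσ)
  have hup := log_card_colouredPerms_le univ R
  simp only [hout, sum_const, nsmul_eq_mul, card_univ] at hup
  have h1 := Real.log_lt_log (by positivity) hlt
  have h2 := Real.log_le_log (by positivity) hper
  rw [Real.log_mul (Real.exp_pos _).ne' hQ0.ne', Real.log_exp] at h1
  rw [Real.log_pow, Real.log_div hd0.ne' (Real.exp_pos 1).ne', Real.log_exp] at h2
  have h3 : rowBound d ≤ Real.log d - 1 + (2 * Real.log (d + 1) + 1) / d := by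
    rw [rowBound, div_le_iff₀ hd0, add_mul, div_mul_cancel₀ _ hd0.ne', Nat.factorial_succ,
      Nat.cast_mul, Real.log_mul (by positivity) (by positivity)]
    have h4 := log_factorial_le hd
    have h5 : Real.log d ≤ Real.log (d + 1) := Real.log_le_log hd0 (by linarith)
    push_cast
    linarith
  have h6 : (Fintype.card α : ℝ) * rowBound d ≤
      Fintype.card α * (Real.log d - 1 + (2 * Real.log (d + 1) + 1) / d) := by gcongr
  have h7 : B = Fintype.card α * ((2 * Real.log (d + 1) + 1) / d) := by rw [hB]; ring
  rw [h7] at h1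
  linarith

end FewCyclesPermutation

section Orientation

open Finset

variable {V : Type} [Fintype V] [DecidableEq V]

theorem deg_eq_card_filter {V : Type} [Fintype V] (G : SimpleGraph V) (v : V) :
    deg G v = (univ.filter fun w => G.Adj v w).card := by
  rw [deg, ← Set.ncard_coe_finset]
  congr 1
  ext w
  simp

/-- `D` is an orientation of `H` with all in- and outdegrees equal to `k`. -/
structure IsBalancedOrientation (H : SimpleGraph V) (k : ℕ) (D : V → V → Prop) : Prop where
  adj_iff : ∀ v w, H.Adj v w ↔ D v w ∨ D w v
  antisymm : ∀ v w, D v w → ¬ D w v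
  out : ∀ v, (univ.filter fun w => D v w).card = k
  into : ∀ w, (univ.filter fun v => D v w).card = k

theorem card_filter_mem_sym2 {V : Type} [Fintype V] [DecidableEq V] (e : Sym2 V)
    (he : ¬ e.IsDiag) : (univ.filter fun v => v ∈ e).card = 2 := by
  induction e using Sym2.ind with
  | _ a b =>
    have hab : a ≠ b := by simpa using he
    rw [← card_pair hab]
    congr 1
    ext v
    simp

theorem exists_balancedOrientation (H : SimpleGraph V) {k : ℕ} (hH : ∀ v, deg H v = 2 * k) :
    ∃ D, IsBalancedOrientation H k D := by
  have hdeg : ∀ v, (univ.filter fun e : H.edgeSet => v ∈ e.1).card = 2 * k := by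
    intro v
    rw [← hH v, deg_eq_card_filter]
    symm
    refine card_bij (fun w hw => ⟨s(v, w), (mem_filter.1 hw).2⟩) (fun w hw => by simp)
      (fun a _ b _ h => Sym2.congr_right.1 (congrArg Subtype.val h)) (fun e he => ?_)
    obtain ⟨e, heE⟩ := e
    simp only [mem_filter, mem_univ, true_and] at he
    obtain ⟨w, rfl⟩ := Sym2.mem_iff_exists.1 he
    exact ⟨w, by simpa using heE, rfl⟩
  let t : H.edgeSet → Finset (V × Fin k) := fun e => univ.filter fun p => p.1 ∈ e.1
  have hall : ∀ A : Finset H.edgeSet, A.card ≤ (A.biUnion t).card := by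
    intro A
    set U := univ.filter fun v => ∃ e ∈ A, v ∈ e.1 with hU
    have h1 : U ×ˢ (univ : Finset (Fin k)) ⊆ A.biUnion t := by
      rintro ⟨v, i⟩ hv
      simp only [hU, mem_product, mem_filter, mem_univ, true_and, and_true] at hv
      obtain ⟨e, he, hve⟩ := hv
      exact mem_biUnion.2 ⟨e, he, by simpa [t] using hve⟩
    have h2 : ∑ e ∈ A, (univ.filter fun v => v ∈ e.1).card =
        ∑ v ∈ U, (A.filter fun e => v ∈ e.1).card := by
      simp only [card_filter]
      rw [sum_comm]
      symm
      refine sum_subset (subset_univ _) fun v _ hv => ?_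
      refine sum_eq_zero fun e he => if_neg fun h => hv ?_
      simp only [hU, mem_filter, mem_univ, true_and]
      exact ⟨e, he, h⟩
    have h3 : ∑ e ∈ A, (univ.filter fun v => v ∈ e.1).card = 2 * A.card := by
      rw [sum_congr rfl fun e _ => card_filter_mem_sym2 e.1 (H.not_isDiag_of_mem_edgeSet e.2),
        sum_const, smul_eq_mul, mul_comm]
    have h4 : ∑ v ∈ U, (A.filter fun e => v ∈ e.1).card ≤ U.card * (2 * k) := by
      rw [← smul_eq_mul]
      refine sum_le_card_nsmul _ _ _ fun v _ => ?_
      rw [← hdeg v]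
      exact card_le_card (filter_subset_filter _ (subset_univ _))
    have h5 := card_le_card h1
    rw [card_product, card_univ, Fintype.card_fin] at h5
    refine le_trans ?_ h5
    nlinarith
  obtain ⟨f, hfinj, hft⟩ := (Finset.all_card_le_biUnion_card_iff_exists_injective t).1 hall
  have hfm : ∀ e, (f e).1 ∈ e.1 := fun e => by simpa [t] using hft e
  obtain ⟨D, hD⟩ : ∃ D : V → V → Prop, ∀ v w, D v w ↔ ∃ h : H.Adj v w, (f ⟨s(v, w), h⟩).1 = v :=
    ⟨_, fun _ _ => Iff.rfl⟩
  have hadj : ∀ v w, H.Adj v w ↔ D v w ∨ D w v := by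
    intro v w
    simp only [hD]
    constructor
    · intro h
      have := hfm ⟨s(v, w), h⟩
      rw [Sym2.mem_iff] at this
      rcases this with h1 | h1
      · exact Or.inl ⟨h, h1⟩
      · refine Or.inr ⟨h.symm, ?_⟩
        refine Eq.trans ?_ h1
        congr 2
        exact Subtype.ext Sym2.eq_swap
    · rintro (⟨h, -⟩ | ⟨h, -⟩)
      · exact h
      · exact h.symm
  have hanti : ∀ v w, D v w → ¬ D w v := by
    simp only [hD]
    rintro v w ⟨h, h1⟩ ⟨h', h2⟩
    have : (f ⟨s(v, w), h⟩).1 = (f ⟨s(w, v), h'⟩).1 := by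
      congr 2
      exact Subtype.ext Sym2.eq_swap
    exact h.ne (by rw [← h1, this, h2])
  have hout : ∀ v, (univ.filter fun w => D v w).card ≤ k := by
    intro v
    rw [← card_range k]
    refine card_le_card_of_injOn
      (fun w => if h : H.Adj v w then ((f ⟨s(v, w), h⟩).2 : ℕ) else 0) ?_ ?_
    · intro a ha
      rw [mem_coe, mem_filter, hD] at ha
      obtain ⟨-, ha, -⟩ := ha
      simp [dif_pos ha]
    · intro a ha b hb h
      rw [mem_coe, mem_filter, hD] at ha hb
      obtain ⟨-, ha, ha1⟩ := ha
      obtain ⟨-, hb, hb1⟩ := hb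
      simp only [dif_pos ha, dif_pos hb] at h
      have := hfinj (Prod.ext (ha1.trans hb1.symm) (Fin.ext h))
      exact Sym2.congr_right.1 (congrArg Subtype.val this)
  have hsum : ∀ v, (univ.filter fun w => D v w).card + (univ.filter fun w => D w v).card =
      2 * k := by
    intro v
    rw [← hH v, deg_eq_card_filter, ← card_union_of_disjoint]
    · congr 1
      ext w
      simp [hadj v w]
    · rw [disjoint_filter]
      exact fun w _ h => hanti v w h
  have hswap : ∑ v, (univ.filter fun w => D v w).card = ∑ v, (univ.filter fun w => D w v).card := by
    simp only [card_filter]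
    rw [sum_comm]
  have htot : ∑ v, (univ.filter fun w => D v w).card = ∑ _v : V, k := by
    have h1 := sum_congr (rfl : (univ : Finset V) = univ) fun v _ => hsum v
    rw [sum_add_distrib, ← hswap, ← mul_sum] at h1
    omega
  have heq := (sum_eq_sum_iff_of_le fun v _ => hout v).1 htot
  exact ⟨D, hadj, hanti, fun v => heq v (mem_univ v), fun v => by
   
    have := heq v (mem_univ v); have := hsum v; omega⟩

end Orientation

section PermutationGraph

open Finset

variable {V : Type} [Fintype V] [DecidableEq V]

/-- The graph whose cycles are the cycles of `σ`. -/
def permGraph {V : Type} (σ : Equiv.Perm V) : SimpleGraph V where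
  Adj v w := v ≠ w ∧ (σ v = w ∨ σ w = v)
  symm := ⟨fun _ _ h => ⟨h.1.symm, h.2.symm⟩⟩
  loopless := ⟨fun _ h => h.1 rfl⟩

theorem deg_permGraph {V : Type} {σ : Equiv.Perm V} {v : V} (h1 : σ v ≠ v) (h2 : σ (σ v) ≠ v) :
    deg (permGraph σ) v = 2 := by
  have hne : σ v ≠ σ.symm v := fun h => h2 (by rw [h]; simp)
  rw [deg, ← Set.ncard_pair hne]
  congr 1
  ext w
  simp only [mem_neighborSet, permGraph, Set.mem_insert_iff, Set.mem_singleton_iff,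
    Equiv.eq_symm_apply]
  constructor
  · rintro ⟨-, h | h⟩
    · exact Or.inl h.symm
    · exact Or.inr h
  · rintro (rfl | h)
    · exact ⟨h1.symm, Or.inl rfl⟩
    · exact ⟨fun hvw => h1 (by rw [hvw] at h ⊢; exact h), Or.inr h⟩

theorem numCycles_permGraph_mul_log_le (σ : Equiv.Perm V) :
    numCycles (permGraph σ) * Real.log 2 ≤ Real.log ((invColourings σ).card) := by
  rw [← Real.log_pow]
  refine Real.log_le_log (by positivity) ?_
  have hcard : 2 ^ numCycles (permGraph σ) =
      (univ : Finset ((permGraph σ).ConnectedComponent → Bool)).card := by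
    rw [card_univ, Fintype.card_fun, Fintype.card_bool, numCycles, Nat.card_eq_fintype_card]
  have : 2 ^ numCycles (permGraph σ) ≤ (invColourings σ).card := by
    rw [hcard]
    refine card_le_card_of_injOn (fun c v => c ((permGraph σ).connectedComponentMk v)) ?_ ?_
    · intro c _
      rw [mem_coe, invColourings, mem_filter]
      refine ⟨mem_univ _, fun v => ?_⟩
      dsimp only
      congr 1
      rw [ConnectedComponent.eq]
      by_cases h : σ v = v
      · rw [h]
      · exact Adj.reachable ⟨h, Or.inr rfl⟩
    · intro c _ c' _ h
      funext x
      induction x using ConnectedComponent.ind with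
      | _ v => exact congrFun h v
  exact_mod_cast this

theorem deg_sdiff {V : Type} [Finite V] {G F : SimpleGraph V} (h : F ≤ G) (v : V) :
    deg (G \ F) v = deg G v - deg F v := by
  have hsub : F.neighborSet v ⊆ G.neighborSet v := fun w hw => h hw
  rw [deg, deg, deg, ← Set.ncard_sdiff hsub (Set.toFinite _)]
  rfl

/-- A bound for the number of cycles, times `log 2`, of a well chosen 2-factor of a
`2 * k`-regular graph. -/
noncomputable def cycleBound (n k : ℕ) : ℝ := n / k * (2 * Real.log (k + 1) + 1)

theorem exists_twoFactor (G : SimpleGraph V) {k : ℕ} (hk : 1 ≤ k) (hG : ∀ v, deg G v = 2 * k) :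
    ∃ F ≤ G, (∀ v, deg F v = 2) ∧
      numCycles F * Real.log 2 ≤ cycleBound (Fintype.card V) k := by
  obtain ⟨D, hD⟩ := exists_balancedOrientation G hG
  obtain ⟨σ, hσ, hc⟩ := exists_perm_log_invColourings_le hk hD.out hD.into
  refine ⟨permGraph σ, ?_, fun v => deg_permGraph (fun h => ?_) (fun h => ?_),
    (numCycles_permGraph_mul_log_le σ).trans hc⟩
  · rintro v w ⟨-, h | h⟩
    · exact (hD.adj_iff v w).2 (Or.inl (h ▸ hσ v))
    · exact (hD.adj_iff v w).2 (Or.inr (h ▸ hσ w))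
  · have := hσ v
    rw [h] at this
    exact hD.antisymm _ _ this this
  · have := hσ (σ v)
    rw [h] at this
    exact hD.antisymm _ _ this (hσ v)

theorem exists_twoFactorization (G : SimpleGraph V) {k : ℕ} (hG : ∀ v, deg G v = 2 * k) :
    ∃ F : ℕ → SimpleGraph V, (∀ i < k, F i ≤ G ∧ ∀ v, deg (F i) v = 2) ∧
      (∀ i < k, ∀ j < k, i ≠ j → Disjoint (F i).edgeSet (F j).edgeSet) ∧
      (∀ v w, G.Adj v w → ∃ i < k, (F i).Adj v w) ∧
      ∑ i ∈ range k, numCycles (F i) * Real.log 2 ≤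
        ∑ i ∈ range k, cycleBound (Fintype.card V) (i + 1) := by
  induction k generalizing G with
  | zero =>
    refine ⟨fun _ => ⊥, by simp, by simp, fun v w h => ?_, by simp⟩
    have h0 := hG v
    rw [mul_zero, deg, Set.ncard_eq_zero (Set.toFinite _)] at h0
    exact absurd (show w ∈ G.neighborSet v from h) (by simp [h0])
  | succ k ih =>
    obtain ⟨F₀, hle, hdeg, hc⟩ := exists_twoFactor G (Nat.le_add_left 1 k) hG
    obtain ⟨F, h1, h2, h3, h4⟩ := ih (G \ F₀) fun v => by
      rw [deg_sdiff hle, hG, hdeg]; omega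
    have hF : ∀ i < k, Function.update F k F₀ i = F i := fun i hi =>
      Function.update_of_ne hi.ne _ _
    have hdis : ∀ i < k, Disjoint (F i).edgeSet F₀.edgeSet := fun i hi => by
      rw [disjoint_edgeSet]
      exact (disjoint_sdiff_self_left).mono_left (h1 i hi).1
    refine ⟨Function.update F k F₀, fun i hi => ?_, fun i hi j hj hij => ?_, fun v w h => ?_, ?_⟩
    · rcases Nat.lt_succ_iff_lt_or_eq.1 hi with hi | rfl
      · rw [hF i hi]
        exact ⟨(h1 i hi).1.trans sdiff_le, (h1 i hi).2⟩
      · rw [Function.update_self]; exact ⟨hle, hdeg⟩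
    · rcases Nat.lt_succ_iff_lt_or_eq.1 hi with hi | rfl
      · rw [hF i hi]
        rcases Nat.lt_succ_iff_lt_or_eq.1 hj with hj | rfl
        · rw [hF j hj]; exact h2 i hi j hj hij
        · rw [Function.update_self]; exact hdis i hi
      · rw [Function.update_self]
        have hj : j < i := by omega
        rw [hF j hj]; exact (hdis j hj).symm
    · by_cases h0 : F₀.Adj v w
      · exact ⟨k, by omega, by simpa using h0⟩
      · obtain ⟨i, hi, h⟩ := h3 v w ⟨h, h0⟩
        exact ⟨i, by omega, by rwa [hF i hi]⟩
    · rw [sum_range_succ, sum_range_succ, Function.update_self]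
      refine add_le_add ?_ (by exact_mod_cast hc)
      rw [sum_congr rfl fun i hi => by rw [hF i (mem_range.1 hi)]]
      exact h4

end PermutationGraph

section SpreadColouring

open Finset

theorem one_add_two_pow_div_le {k : ℕ} (hk : k ≤ 2) {K A : ℝ} (hK : 0 < K) (hA : 3 * K / 4 ≤ A) :
    1 + ((2 : ℝ) ^ k - 1) / A ≤ (1 + 2 / K) ^ k := by
  have hA0 : 0 < A := by linarith
  interval_cases k
  · simp
  · have : 1 / A ≤ 2 / K := by rw [div_le_div_iff₀ hA0 hK]; linarith
    norm_num; linarith [this, one_div A]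
  · have h1 : 3 / A ≤ 4 / K := by rw [div_le_div_iff₀ hA0 hK]; linarith
    have h2 : 0 ≤ (2 / K) ^ 2 := by positivity
    have h3 : 4 / K = 2 * (2 / K) := by ring
    norm_num
    nlinarith

/-- The edges of a sparse edge set can be coloured properly with classes of bounded size such that
no colour class meets any set of a given family too often (measured by exponential weights). -/
theorem exists_spread_colouring {V I : Type} [DecidableEq V] [Fintype I] {K Δ B μ : ℕ}
    (hμ : 0 < μ) (hK : 0 < K) (hKB : 4 * (2 * Δ + B) ≤ K) (k : I → Sym2 V → ℕ)
    (hk : ∀ x e, k x e ≤ 2) (E : Finset (Sym2 V))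
    (hdeg : ∀ v, (E.filter fun e => v ∈ e).card ≤ Δ) (hcard : E.card ≤ μ * B)
    (g : I → ℝ) (hg : ∀ x, 0 ≤ g x) :
    ∃ c : Sym2 V → Fin K,
      (∀ e ∈ E, ∀ f ∈ E, e ≠ f → c e = c f → ∀ v, v ∈ e → v ∉ f) ∧
      (∀ γ, (E.filter fun e => c e = γ).card ≤ μ) ∧
      ∑ x, g x * ∑ γ, (2 : ℝ) ^ (∑ f ∈ E.filter (fun f => c f = γ), k x f) ≤
        K * ∑ x, g x * (1 + 2 / (K : ℝ)) ^ (∑ f ∈ E, k x f) := by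
  induction E using Finset.induction_on generalizing g with
  | empty =>
    refine ⟨fun _ => ⟨0, hK⟩, by simp, by simp, le_of_eq ?_⟩
    simp [← sum_mul, mul_comm]
  | insert e E he ih =>
    have hK0 : (0 : ℝ) < K := by exact_mod_cast hK
    have hsub : E ⊆ insert e E := subset_insert _ _
    obtain ⟨c, hc1, hc2, hc3⟩ := ih
      (fun v => (card_le_card (filter_subset_filter _ hsub)).trans (hdeg v))
      ((card_le_card hsub).trans hcard) (fun x => g x * (1 + 2 / (K : ℝ)) ^ k x e)
      (fun x => mul_nonneg (hg x) (by positivity))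
    set U := (E.filter fun f => ∃ v, v ∈ e ∧ v ∈ f).image c with hU
    set Full := univ.filter fun γ => μ ≤ (E.filter fun f => c f = γ).card with hFull
    set Al := univ \ (U ∪ Full) with hAl
    have hUc : U.card ≤ 2 * Δ := by
      refine card_image_le.trans ?_
      induction e using Sym2.ind with
      | _ a b =>
        have h1 : (E.filter fun f => ∃ v, v ∈ s(a, b) ∧ v ∈ f) ⊆
            ((insert s(a, b) E).filter fun f => a ∈ f) ∪
              ((insert s(a, b) E).filter fun f => b ∈ f) := by
          intro f hf
          rw [mem_filter] at hf
          obtain ⟨hfE, v, hv, hvf⟩ := hf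
          rw [mem_union, mem_filter, mem_filter]
          rcases Sym2.mem_iff.1 hv with rfl | rfl
          · exact Or.inl ⟨hsub hfE, hvf⟩
          · exact Or.inr ⟨hsub hfE, hvf⟩
        have h2 := card_le_card h1
        have h3 := card_union_le ((insert s(a, b) E).filter fun f => a ∈ f)
          ((insert s(a, b) E).filter fun f => b ∈ f)
        have h4 := hdeg a
        have h5 := hdeg b
        omega
    have hFc : Full.card ≤ B := by
      have h1 : Full.card * μ ≤ ∑ γ ∈ Full, (E.filter fun f => c f = γ).card :=
        card_nsmul_le_sum _ _ _ fun γ hγ => (mem_filter.1 hγ).2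
      have h2 : ∑ γ ∈ Full, (E.filter fun f => c f = γ).card ≤ E.card := by
        rw [card_eq_sum_card_fiberwise (f := c) (s := E) (t := univ) (fun _ _ => by simp)]
        exact sum_le_sum_of_subset (subset_univ _)
      have h3 := (card_le_card hsub).trans hcard
      have h4 : μ * Full.card ≤ μ * B := by rw [mul_comm]; omega
      exact Nat.le_of_mul_le_mul_left h4 hμ
    have hAlc : 3 * K ≤ 4 * Al.card := by
      have h1 := card_union_le U Full
      have h2 := le_card_sdiff (U ∪ Full) (univ : Finset (Fin K))
      rw [card_univ, Fintype.card_fin, ← hAl] at h2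
      omega
    have hAlR : 3 * (K : ℝ) / 4 ≤ Al.card := by
      have : (3 * K : ℝ) ≤ 4 * Al.card := by exact_mod_cast hAlc
      linarith
    have hAl0 : (0 : ℝ) < Al.card := by linarith
    set N : I → Fin K → ℕ := fun x γ => ∑ f ∈ E.filter (fun f => c f = γ), k x f with hN
    set Φ : Fin K → ℝ := fun γ => ∑ x, g x * (∑ γ', (2 : ℝ) ^ N x γ' +
      ((2 : ℝ) ^ k x e - 1) * 2 ^ N x γ) with hΦ
    set T := ∑ x, g x * (1 + 2 / (K : ℝ)) ^ k x e * ∑ γ, (2 : ℝ) ^ N x γ with hT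
    have havg : ∑ γ ∈ Al, Φ γ ≤ ∑ γ ∈ Al, T := by
      rw [sum_const, nsmul_eq_mul, hT, hΦ, sum_comm, mul_sum]
      refine sum_le_sum fun x _ => ?_
      rw [← mul_sum, sum_add_distrib, sum_const, nsmul_eq_mul, ← mul_sum]
      have h1 : ∑ γ ∈ Al, (2 : ℝ) ^ N x γ ≤ ∑ γ, (2 : ℝ) ^ N x γ :=
        sum_le_sum_of_subset_of_nonneg (subset_univ _) fun _ _ _ => by positivity
      have h2 : (0 : ℝ) ≤ 2 ^ k x e - 1 := sub_nonneg.2 (one_le_pow₀ (by norm_num))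
      have h3 := one_add_two_pow_div_le (hk x e) hK0 hAlR
      have h4 : (0 : ℝ) ≤ ∑ γ, (2 : ℝ) ^ N x γ := sum_nonneg fun _ _ => by positivity
      calc g x * (Al.card * ∑ γ, (2 : ℝ) ^ N x γ + (2 ^ k x e - 1) * ∑ γ ∈ Al, (2 : ℝ) ^ N x γ)
          ≤ g x * (Al.card * ∑ γ, (2 : ℝ) ^ N x γ + (2 ^ k x e - 1) * ∑ γ, (2 : ℝ) ^ N x γ) := by
            have := hg x
            gcongr
        _ = Al.card * (g x * (1 + ((2 : ℝ) ^ k x e - 1) / Al.card) * ∑ γ, (2 : ℝ) ^ N x γ) := by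
            field_simp
        _ ≤ _ := by
            have := hg x
            gcongr
    obtain ⟨γ, hγ, hle⟩ := exists_le_of_sum_le
      (card_pos.1 (by exact_mod_cast hAl0)) havg
    rw [hAl, mem_sdiff, mem_union, not_or] at hγ
    obtain ⟨-, hγU, hγF⟩ := hγ
    have hupd : ∀ f ∈ E, Function.update c e γ f = c f := fun f hf =>
      Function.update_of_ne (fun h : f = e => he (h ▸ hf)) _ _
    have hclass : ∀ γ', (insert e E).filter (fun f => Function.update c e γ f = γ') =
        if γ = γ' then insert e (E.filter fun f => c f = γ') else E.filter fun f => c f = γ' := by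
      intro γ'
      rw [filter_insert, Function.update_self, filter_congr fun f hf => by rw [hupd f hf]]
    have hfree : ∀ f ∈ E, c f = γ → ∀ v, v ∈ e → v ∉ f := by
      intro f hf hcf v hv hvf
      exact hγU (mem_image.2 ⟨f, mem_filter.2 ⟨hf, v, hv, hvf⟩, hcf⟩)
    refine ⟨Function.update c e γ, ?_, fun γ' => ?_, ?_⟩
    · intro f hf f' hf' hne heq v hv hv'
      rcases mem_insert.1 hf with rfl | hm
      · rcases mem_insert.1 hf' with rfl | hm'
        · exact hne rfl
        · rw [Function.update_self, hupd f' hm'] at heq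
          exact hfree f' hm' heq.symm v hv hv'
      · rcases mem_insert.1 hf' with rfl | hm'
        · rw [Function.update_self, hupd f hm] at heq
          exact hfree f hm heq v hv' hv
        · rw [hupd f hm, hupd f' hm'] at heq
          exact hc1 f hm f' hm' hne heq v hv hv'
    · rw [hclass]
      split_ifs with h
      · subst h
        rw [card_insert_of_notMem (by simp [he])]
        simpa [hFull] using hγF
      · exact hc2 γ'
    · have hcost : ∀ x, ∑ γ', (2 : ℝ) ^ (∑ f ∈ (insert e E).filter
          (fun f => Function.update c e γ f = γ'), k x f) =
          ∑ γ', (2 : ℝ) ^ N x γ' + ((2 : ℝ) ^ k x e - 1) * 2 ^ N x γ := by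
        intro x
        have : ∀ γ', (2 : ℝ) ^ (∑ f ∈ (insert e E).filter
            (fun f => Function.update c e γ f = γ'), k x f) =
            2 ^ N x γ' + if γ = γ' then ((2 : ℝ) ^ k x e - 1) * 2 ^ N x γ' else 0 := by
          intro γ'
          rw [hclass]
          split_ifs with h
          · rw [sum_insert (by simp [he]), pow_add]; ring
          · simp [hN]
        simp only [this, sum_add_distrib, sum_ite_eq, mem_univ, if_true]
      simp only [hcost]
      refine hle.trans (hc3.trans (le_of_eq ?_))
      congr 1
      refine sum_congr rfl fun x _ => ?_
      rw [sum_insert he, pow_add]; ring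

end SpreadColouring

section SpreadColouringOfSets

open Finset

/-- The vertices covered by the edges of `E` coloured `γ`. -/
noncomputable def colourSupport {V : Type} [Fintype V] {K : ℕ} (E : Finset (Sym2 V))
    (c : Sym2 V → Fin K) (γ : Fin K) : Finset V :=
  univ.filter fun w => ∃ e ∈ E, c e = γ ∧ w ∈ e

theorem mem_colourSupport {V : Type} [Fintype V] {K : ℕ} {E : Finset (Sym2 V)}
    {c : Sym2 V → Fin K} {γ : Fin K} {w : V} :
    w ∈ colourSupport E c γ ↔ ∃ e ∈ E, c e = γ ∧ w ∈ e := by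
  simp [colourSupport]

theorem exists_colouring_spread_on_sets {V I : Type} [Fintype V] [DecidableEq V] [Fintype I]
    {K Δ B μ d : ℕ} (hμ : 0 < μ) (hK : 0 < K) (hKB : 4 * (2 * Δ + B) ≤ K) (X : I → Finset V)
    (hX : ∀ x, (X x).card ≤ d) (E : Finset (Sym2 V)) (hE : ∀ e ∈ E, ¬ e.IsDiag)
    (hdeg : ∀ v, (E.filter fun e => v ∈ e).card ≤ Δ) (hcard : E.card ≤ μ * B) :
    ∃ c : Sym2 V → Fin K,
      (∀ e ∈ E, ∀ f ∈ E, e ≠ f → c e = c f → ∀ v, v ∈ e → v ∉ f) ∧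
      (∀ γ, (E.filter fun e => c e = γ).card ≤ μ) ∧
      ∀ x γ, ((X x ∩ colourSupport E c γ).card : ℝ) * Real.log 2 ≤
        Real.log (Fintype.card I * K) + 2 * d * Δ / K := by
  have hK0 : (0 : ℝ) < K := by exact_mod_cast hK
  let k : I → Sym2 V → ℕ := fun x e => if e.IsDiag then 0 else ((X x).filter fun w => w ∈ e).card
  have hk : ∀ x e, k x e ≤ 2 := by
    intro x e
    dsimp only [k]
    split_ifs with h
    · norm_num
    · induction e using Sym2.ind with
      | _ a b =>
        refine (card_le_card (t := {a, b}) fun w hw => ?_).trans card_le_two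
        simpa using (mem_filter.1 hw).2
  have hkE : ∀ x, ∀ F ⊆ E, ∑ e ∈ F, k x e = ∑ w ∈ X x, (F.filter fun e => w ∈ e).card := by
    intro x F hF
    rw [sum_congr rfl fun e he => if_neg (hE e (hF he))]
    simp only [card_filter]
    rw [sum_comm]
  obtain ⟨c, h1, h2, h3⟩ := exists_spread_colouring hμ hK hKB k hk E hdeg hcard (fun _ => 1)
    (fun _ => zero_le_one)
  refine ⟨c, h1, h2, fun x γ => ?_⟩
  simp only [one_mul] at h3
  have h4 : (2 : ℝ) ^ (X x ∩ colourSupport E c γ).card ≤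
      ∑ x, ∑ γ, (2 : ℝ) ^ (∑ f ∈ E.filter (fun f => c f = γ), k x f) := by
    have h5 : (X x ∩ colourSupport E c γ).card ≤ ∑ f ∈ E.filter (fun f => c f = γ), k x f := by
      rw [hkE x _ (filter_subset _ _), card_eq_sum_ones, ← filter_mem_eq_inter, sum_filter]
      refine sum_le_sum fun w _ => ?_
      split_ifs with h
      · simp only [colourSupport, mem_filter, mem_univ, true_and] at h
        obtain ⟨e, he, hc, hw⟩ := h
        exact card_pos.2 ⟨e, by simp [he, hc, hw]⟩
      · exact Nat.zero_le _
    calc (2 : ℝ) ^ (X x ∩ colourSupport E c γ).card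
        ≤ 2 ^ (∑ f ∈ E.filter (fun f => c f = γ), k x f) :=
          pow_le_pow_right₀ (by norm_num) h5
      _ ≤ ∑ γ, (2 : ℝ) ^ (∑ f ∈ E.filter (fun f => c f = γ), k x f) :=
          single_le_sum (f := fun γ => (2 : ℝ) ^ (∑ f ∈ E.filter (fun f => c f = γ), k x f))
            (fun _ _ => by positivity) (mem_univ γ)
      _ ≤ _ := single_le_sum
            (f := fun x => ∑ γ, (2 : ℝ) ^ (∑ f ∈ E.filter (fun f => c f = γ), k x f))
            (fun _ _ => sum_nonneg fun _ _ => by positivity) (mem_univ x)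
  have h6 : K * ∑ x, (1 + 2 / (K : ℝ)) ^ (∑ f ∈ E, k x f) ≤
      Fintype.card I * K * Real.exp (2 * d * Δ / K) := by
    have : ∀ x, (1 + 2 / (K : ℝ)) ^ (∑ f ∈ E, k x f) ≤ Real.exp (2 * d * Δ / K) := by
      intro x
      have h7 : ∑ f ∈ E, k x f ≤ d * Δ := by
        rw [hkE x E Subset.rfl]
        refine (sum_le_card_nsmul _ _ Δ fun w _ => hdeg w).trans ?_
        rw [smul_eq_mul]
        exact Nat.mul_le_mul_right _ (hX x)
      calc (1 + 2 / (K : ℝ)) ^ (∑ f ∈ E, k x f) ≤ (1 + 2 / (K : ℝ)) ^ (d * Δ) :=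
            pow_le_pow_right₀ (by linarith [show (0 : ℝ) ≤ 2 / K by positivity]) h7
        _ ≤ Real.exp (2 / K) ^ (d * Δ) := by
            gcongr
            rw [add_comm]
            exact Real.add_one_le_exp _
        _ = _ := by
            rw [← Real.exp_nat_mul]
            congr 1
            push_cast
            ring
    calc _ ≤ K * ∑ x : I, Real.exp (2 * d * Δ / K) := by
            gcongr
            exact this _
      _ = _ := by rw [sum_const, card_univ, nsmul_eq_mul]; ring
  have hI : (0 : ℝ) < Fintype.card I := by exact_mod_cast Fintype.card_pos_iff.2 ⟨x⟩
  have h8 := Real.log_le_log (by positivity) (h4.trans (h3.trans h6))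
  rwa [Real.log_pow, Real.log_mul (by positivity) (Real.exp_pos _).ne', Real.log_exp] at h8

end SpreadColouringOfSets

section Expansion

open Finset

/-- The number of pairs in `S × T` related by `Q`. -/
noncomputable def arcs {V : Type} (Q : V → V → Prop) (S T : Finset V) : ℕ :=
  ∑ s ∈ S, (T.filter fun t => Q s t).card

section Arcs

variable {V : Type} (Q : V → V → Prop)

theorem arcs_mono {S S' T T' : Finset V} (hS : S ⊆ S') (hT : T ⊆ T') :
    arcs Q S T ≤ arcs Q S' T' :=
  (sum_le_sum fun _ _ => card_le_card (filter_subset_filter _ hT)).trans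
    (sum_le_sum_of_subset hS)

theorem arcs_swap (S T : Finset V) : arcs (fun v w => Q w v) S T = arcs Q T S := by
  simp only [arcs, card_filter]
  rw [sum_comm]

theorem arcs_union_right_le [DecidableEq V] (S T T' : Finset V) :
    arcs Q S (T ∪ T') ≤ arcs Q S T + arcs Q S T' := by
  rw [arcs, arcs, arcs, ← sum_add_distrib]
  refine sum_le_sum fun s _ => ?_
  rw [filter_union]
  exact card_union_le _ _

theorem two_mul_arcs_self_le {G : SimpleGraph V} {D : V → V → Prop}
    (hDG : ∀ v w, D v w → G.Adj v w) (hanti : ∀ v w, D v w → ¬ D w v) (U : Finset V) :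
    2 * arcs D U U ≤ arcs G.Adj U U := by
  have h2 : 2 * arcs D U U = arcs (fun v w => D w v) U U + arcs D U U := by
    rw [arcs_swap]; ring
  rw [h2, arcs, arcs, arcs, ← sum_add_distrib]
  refine sum_le_sum fun s _ => ?_
  rw [← card_union_of_disjoint (disjoint_filter.2 fun w _ h => hanti w s h)]
  refine card_le_card fun w hw => ?_
  rw [mem_union, mem_filter, mem_filter] at hw
  rw [mem_filter]
  rcases hw with ⟨h, h'⟩ | ⟨h, h'⟩
  · exact ⟨h, (hDG _ _ h').symm⟩
  · exact ⟨h, hDG _ _ h'⟩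

theorem arcs_self_le_two_mul [Fintype V] {G : SimpleGraph V} {D : V → V → Prop} {d : ℕ} {δ : ℝ}
    (hDG : ∀ v w, D v w → G.Adj v w) (hanti : ∀ v w, D v w → ¬ D w v)
    (hout : ∀ v, (univ.filter fun w => D v w).card = d)
    (hin : ∀ w, (univ.filter fun v => D v w).card = d)
    (hdeg : ∀ v, (deg G v : ℝ) ≤ 2 * d + δ) (P : Finset V) :
    (arcs G.Adj P P : ℝ) ≤ 2 * arcs D P P + δ * P.card := by
  have key : ∀ v, ((P.filter fun w => G.Adj v w).card : ℝ) ≤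
      (P.filter fun w => D v w).card + (P.filter fun w => D w v).card + δ := by
    intro v
    have h1 : (univ.filter fun w => G.Adj v w ∧ ¬ (D v w ∨ D w v)).card + 2 * d = deg G v := by
      have h2 : (univ.filter fun w => D v w ∨ D w v).card = 2 * d := by
        rw [filter_or, card_union_of_disjoint (disjoint_filter.2 fun w _ h => hanti v w h), hout,
          hin]
        ring
      rw [← h2, deg_eq_card_filter, ← card_union_of_disjoint
        (disjoint_filter.2 fun w _ h => h.2), ← filter_or]
      congr 1
      ext w
      simp only [mem_filter, mem_univ, true_and]
      constructor
      · rintro (h | h | h)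
        · exact h.1
        · exact hDG _ _ h
        · exact (hDG _ _ h).symm
      · intro h
        tauto
    have h3 : (P.filter fun w => G.Adj v w) ⊆ (P.filter fun w => D v w) ∪
        (P.filter fun w => D w v) ∪ univ.filter fun w => G.Adj v w ∧ ¬ (D v w ∨ D w v) := by
      intro w
      simp only [mem_union, mem_filter, mem_univ, true_and]
      tauto
    have h4 := (card_le_card h3).trans ((card_union_le _ _).trans
      (Nat.add_le_add_right (card_union_le _ _) _))
    have h5 := hdeg v
    rw [← h1] at h5
    have h6 : ((P.filter fun w => G.Adj v w).card : ℝ) ≤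
      (P.filter fun w => D v w).card + (P.filter fun w => D w v).card +
        (univ.filter fun w => G.Adj v w ∧ ¬ (D v w ∨ D w v)).card := by exact_mod_cast h4
    push_cast at h5
    linarith
  have h := sum_le_sum fun v (_ : v ∈ P) => key v
  rw [sum_add_distrib, sum_add_distrib, sum_const, nsmul_eq_mul] at h
  have h7 := arcs_swap D P P
  simp only [arcs] at h7 ⊢
  have h8 : ∑ v ∈ P, ((P.filter fun w => D w v).card : ℝ) =
      ∑ v ∈ P, ((P.filter fun w => D v w).card : ℝ) := by exact_mod_cast h7
  push_cast
  linarith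

end Arcs

/-- Arcs between large sets in a balanced orientation of most of a jumbled graph. -/
theorem arcs_gt {V : Type} [Fintype V] [DecidableEq V] {G : SimpleGraph V} {D : V → V → Prop}
    {d : ℕ} {r : ℝ} (hr : 0 < r) (hn : 10 ^ 4 ≤ Fintype.card V)
    (hDG : ∀ v w, D v w → G.Adj v w) (hanti : ∀ v w, D v w → ¬ D w v)
    (hout : ∀ v, (univ.filter fun w => D v w).card = d)
    (hin : ∀ w, (univ.filter fun v => D v w).card = d)
    (hdeg : ∀ v, (deg G v : ℝ) ≤ 2 * d + r / 1000) (hd : 999 / 1000 * r ≤ 2 * d)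
    (hup : ∀ U : Finset V, (arcs G.Adj U U : ℝ) ≤
      r / Fintype.card V * (U.card : ℝ) ^ 2 + r / 500 * U.card)
    (hlow : ∀ U : Finset V, r / Fintype.card V * ((U.card : ℝ) * (U.card - 1)) - r / 500 * U.card ≤
      arcs G.Adj U U)
    {S T B : Finset V} (hTB : Disjoint T B) (hB : (B.card : ℝ) ≤ Fintype.card V / 10 ^ 6)
    (hST : S.card + T.card + B.card = Fintype.card V + 1) (hle : S.card ≤ T.card)
    (hBD : ∀ v, ((B.filter fun w => D v w).card : ℝ) ≤ 9 / 100 * r) :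
    r / 100 * S.card < arcs D S T := by
  set n := Fintype.card V with hn'
  have hn0 : (0 : ℝ) < n := by
    have : 0 < n := by omega
    exact_mod_cast this
  have hnR : (10 ^ 4 : ℝ) ≤ n := by exact_mod_cast hn
  have hcTB := card_union_of_disjoint hTB
  have hTBn : T.card + B.card ≤ n := by rw [← hcTB]; exact card_le_univ _
  set s : ℝ := (S.card : ℝ) with hs
  have hs1 : 1 ≤ s := by
    have : 1 ≤ S.card := by omega
    rw [hs]; exact_mod_cast this
  have hall : (arcs D S univ : ℝ) = d * s := by
    rw [hs, arcs]
    simp only [hout, sum_const, smul_eq_mul]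
    push_cast
    ring
  have hself : ∀ U : Finset V, (arcs D U U : ℝ) ≤
      r / n * (U.card : ℝ) ^ 2 / 2 + r / 1000 * U.card := by
    intro U
    have h1 : (2 * arcs D U U : ℝ) ≤ arcs G.Adj U U := by
      exact_mod_cast two_mul_arcs_self_le hDG hanti U
    have h2 := hup U
    linarith
  have hbound : ∀ (U : Finset V) (u : ℝ), (U.card : ℝ) ≤ u → (arcs D U U : ℝ) ≤
      r / n * u ^ 2 / 2 + r / 1000 * u := by
    intro U u hu
    refine (hself U).trans ?_
    gcongr
  have hds : 999 / 2000 * r * s ≤ d * s := by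
    have : 999 / 2000 * r ≤ d := by linarith
    gcongr
  rcases le_or_gt s (n / 6) with hsmall | hlarge
  · set X := univ \ (T ∪ B) with hX
    have hXc : (X.card : ℝ) = s - 1 := by
      have h1 : X.card + (T.card + B.card) = n := by
        rw [← hcTB, hX, card_sdiff_add_card, union_eq_left.2 (subset_univ _), card_univ]
      have h2 : X.card + 1 = S.card := by omega
      rw [hs, ← h2]; push_cast; ring
    have h1 : arcs D S univ ≤ arcs D S T + arcs D S B + arcs D S X := by
      have : (univ : Finset V) = T ∪ B ∪ X := by rw [hX, union_sdiff_of_subset (subset_univ _)]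
      rw [this]
      exact (arcs_union_right_le D S _ _).trans
        (Nat.add_le_add_right (arcs_union_right_le D S _ _) _)
    have h1' : (arcs D S univ : ℝ) ≤ arcs D S T + arcs D S B + arcs D S X := by exact_mod_cast h1
    have h2 : (arcs D S B : ℝ) ≤ 9 / 100 * r * s := by
      rw [arcs]
      push_cast
      refine (sum_le_card_nsmul _ _ _ fun v _ => hBD v).trans ?_
      rw [nsmul_eq_mul, mul_comm]
    have h3 : (arcs D S X : ℝ) ≤ r / n * (2 * s) ^ 2 / 2 + r / 1000 * (2 * s) := by
      have h4 : (arcs D S X : ℝ) ≤ arcs D (S ∪ X) (S ∪ X) := by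
        exact_mod_cast arcs_mono D subset_union_left subset_union_right
      refine h4.trans (hbound _ _ ?_)
      have h5 : ((S ∪ X).card : ℝ) ≤ S.card + X.card := by exact_mod_cast card_union_le S X
      rw [hXc] at h5
      linarith
    have h6 : r / n * (2 * s) ^ 2 / 2 ≤ r * s / 3 := by
      have : r / n * (2 * s) ^ 2 / 2 = 2 * r * s * (s / n) := by ring
      rw [this]
      have h7 : s / n ≤ 1 / 6 := by rw [div_le_iff₀ hn0]; linarith
      have h8 : 2 * r * s * (s / n) ≤ 2 * r * s * (1 / 6) := by gcongr
      linarith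
    have hrs : 0 < r * s := by positivity
    rw [hall] at h1'
    linarith
  · set P := S ∩ T with hP
    set W := univ \ (S ∪ T) with hW
    have hc1 : P.card + n = W.card + S.card + T.card := by
      have h1 := card_union_add_card_inter S T
      have h2 : W.card + (S ∪ T).card = n := by
        rw [hW, card_sdiff_add_card, union_eq_left.2 (subset_univ _), card_univ]
      rw [hP]
      omega
    have hs2 : s ≤ (n + 1) / 2 := by
      have : 2 * S.card ≤ n + 1 := by omega
      have : (2 * S.card : ℝ) ≤ n + 1 := by exact_mod_cast this
      linarith
    rcases le_or_gt (P.card : ℝ) (3 / 8 * s) with hPs | hPl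
    · have hWc : (W.card : ℝ) ≤ P.card + n / 10 ^ 6 := by
        have : W.card ≤ P.card + B.card := by omega
        have : (W.card : ℝ) ≤ P.card + B.card := by exact_mod_cast this
        linarith
      have h1 : arcs D S univ ≤ arcs D S T + arcs D (S ∪ W) (S ∪ W) := by
        have : (univ : Finset V) = T ∪ (S ∪ W) := by
          rw [hW, ← union_assoc, union_comm T S, union_sdiff_of_subset (subset_univ _)]
        rw [this]
        exact (arcs_union_right_le D S _ _).trans
          (Nat.add_le_add_left (arcs_mono D subset_union_left Subset.rfl) _)
      have h1' : (arcs D S univ : ℝ) ≤ arcs D S T + arcs D (S ∪ W) (S ∪ W) := by exact_mod_cast h1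
      have h2 : (arcs D (S ∪ W) (S ∪ W) : ℝ) ≤
          r / n * (13751 / 10000 * s) ^ 2 / 2 + r / 1000 * (13751 / 10000 * s) := by
        refine hbound _ _ ?_
        have h5 : ((S ∪ W).card : ℝ) ≤ S.card + W.card := by exact_mod_cast card_union_le S W
        linarith
      have h6 : r / n * (13751 / 10000 * s) ^ 2 / 2 ≤
          r * s * ((13751 / 10000) ^ 2 / 2 * (5001 / 10000)) := by
        have : r / n * (13751 / 10000 * s) ^ 2 / 2 =
          r * s * ((13751 / 10000) ^ 2 / 2 * (s / n)) := by ring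
        rw [this]
        have h7 : s / n ≤ 5001 / 10000 := by rw [div_le_iff₀ hn0]; linarith
        gcongr
      have hrs : 0 < r * s := by positivity
      rw [hall] at h1'
      norm_num at h6 h2
      linarith
    · have h1 : (arcs D P P : ℝ) ≤ arcs D S T := by
        exact_mod_cast arcs_mono D inter_subset_left inter_subset_right
      have h2 := arcs_self_le_two_mul hDG hanti hout hin hdeg P
      have h3 := hlow P
      set p : ℝ := (P.card : ℝ) with hp
      have hp16 : n / 16 < p := by linarith
      have hp0 : 0 < p := by linarith
      have h4 : r * (623 / 10000) * p ≤ r / n * (p * (p - 1)) := by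
        have : r / n * (p * (p - 1)) = r * ((p - 1) / n) * p := by ring
        rw [this]
        have h7 : 623 / 10000 ≤ (p - 1) / n := by rw [le_div_iff₀ hn0]; linarith
        gcongr
      have hrs : r * (3 / 8 * s) < r * p := by gcongr
      have hrs0 : 0 < r * s := by positivity
      linarith

end Expansion

section MatchingContraction

open Finset

theorem exists_perm_of_expansion {α : Type} [Fintype α] [DecidableEq α] {Q : α → α → Prop}
    (h : ∀ S T : Finset α, S.card + T.card = Fintype.card α + 1 → ∃ s ∈ S, ∃ t ∈ T, Q s t) :
    ∃ σ : Equiv.Perm α, ∀ v, Q v (σ v) := by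
  obtain ⟨f, hinj, hf⟩ := (Finset.all_card_le_biUnion_card_iff_exists_injective
    fun v => univ.filter fun w => Q v w).1 (by
      intro S
      by_contra! hlt
      set N := S.biUnion fun v => univ.filter fun w => Q v w with hN
      have h1 := card_compl_add_card N
      have h2 : S.card ≤ Fintype.card α := card_le_univ _
      obtain ⟨T, hTN, hT⟩ := exists_subset_card_eq (s := Nᶜ) (n := Fintype.card α + 1 - S.card)
        (by omega)
      obtain ⟨s, hs, t, ht, hst⟩ := h S T (by omega)
      exact mem_compl.1 (hTN ht) (mem_biUnion.2 ⟨s, hs, by simpa using hst⟩))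
  exact ⟨Equiv.ofBijective f (Finite.injective_iff_bijective.1 hinj), fun v => by
    simpa using hf v⟩

theorem arcs_le_of_forall_not {α : Type} [Fintype α] [DecidableEq α] {R₀ Q : α → α → Prop} {t : ℕ}
    (hout : ∀ v, (univ.filter fun w => R₀ v w ∧ ¬ Q v w).card ≤ t) {S T : Finset α}
    (h : ∀ s ∈ S, ∀ w ∈ T, ¬ Q s w) : arcs R₀ S T ≤ t * S.card := by
  rw [mul_comm, ← smul_eq_mul]
  refine sum_le_card_nsmul _ _ _ fun s hs => (card_le_card fun w hw => ?_).trans (hout s)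
  rw [mem_filter] at hw ⊢
  exact ⟨mem_univ _, hw.2, h s hs w hw.1⟩

theorem exists_regular_subrelation {α : Type} [Fintype α] [DecidableEq α] {R₀ Q : α → α → Prop}
    {t t₀ d : ℕ}
    (hexp : ∀ S T : Finset α, S.card + T.card = Fintype.card α + 1 →
      t * min S.card T.card < arcs R₀ S T)
    (hout : ∀ v, (univ.filter fun w => R₀ v w ∧ ¬ Q v w).card ≤ t₀)
    (hin : ∀ w, (univ.filter fun v => R₀ v w ∧ ¬ Q v w).card ≤ t₀) (hd : t₀ + d ≤ t) :
    ∃ R : α → α → Prop, (∀ v w, R v w → Q v w) ∧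
      (∀ v, (univ.filter fun w => R v w).card = d) ∧
      ∀ w, (univ.filter fun v => R v w).card = d := by
  induction d with
  | zero => exact ⟨fun _ _ => False, by simp, by simp, by simp⟩
  | succ d ih =>
    obtain ⟨R, hRQ, hRout, hRin⟩ := ih (by omega)
    obtain ⟨Q', hQ'⟩ : ∃ Q' : α → α → Prop, ∀ v w, Q' v w ↔ Q v w ∧ ¬ R v w :=
      ⟨_, fun _ _ => Iff.rfl⟩
    have hout' : ∀ v, (univ.filter fun w => R₀ v w ∧ ¬ Q' v w).card ≤ t := by
      intro v
      refine (card_le_card (t := (univ.filter fun w => R₀ v w ∧ ¬ Q v w) ∪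
        univ.filter fun w => R v w) fun w hw => ?_).trans ((card_union_le _ _).trans ?_)
      · simp only [mem_union, mem_filter, mem_univ, true_and, hQ'] at hw ⊢
        tauto
      · rw [hRout]
        have := hout v
        omega
    have hin' : ∀ w, (univ.filter fun v => R₀ v w ∧ ¬ Q' v w).card ≤ t := by
      intro w
      refine (card_le_card (t := (univ.filter fun v => R₀ v w ∧ ¬ Q v w) ∪
        univ.filter fun v => R v w) fun v hv => ?_).trans ((card_union_le _ _).trans ?_)
      · simp only [mem_union, mem_filter, mem_univ, true_and, hQ'] at hv ⊢
        tauto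
      · rw [hRin]
        have := hin w
        omega
    obtain ⟨σ, hσ⟩ := exists_perm_of_expansion (Q := Q') (by
      intro S T hST
      by_contra! hcon
      have h0 := hexp S T hST
      rcases le_total S.card T.card with h | h
      · rw [min_eq_left h] at h0
        exact absurd (arcs_le_of_forall_not hout' hcon) h0.not_ge
      · rw [min_eq_right h, ← arcs_swap] at h0
        exact absurd (arcs_le_of_forall_not (R₀ := fun v w => R₀ w v)
          (Q := fun v w => Q' w v) hin' fun s hs w hw => hcon w hw s hs) h0.not_ge)
    simp only [hQ'] at hσ
    obtain ⟨R', hR'⟩ : ∃ R' : α → α → Prop, ∀ v w, R' v w ↔ R v w ∨ w = σ v :=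
      ⟨_, fun _ _ => Iff.rfl⟩
    refine ⟨R', fun v w h => ?_, fun v => ?_, fun w => ?_⟩
    · rcases (hR' v w).1 h with h | rfl
      · exact hRQ v w h
      · exact (hσ v).1
    · simp only [hR']
      rw [filter_or, card_union_of_disjoint, hRout, filter_eq', if_pos (mem_univ _),
        card_singleton]
      rw [disjoint_filter]
      rintro w - h rfl
      exact (hσ v).2 h
    · have : ∀ v, w = σ v ↔ v = σ.symm w := fun v => by
        rw [Equiv.eq_symm_apply]; exact eq_comm
      simp only [hR', this]
      rw [filter_or, card_union_of_disjoint, hRin, filter_eq', if_pos (mem_univ _),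
        card_singleton]
      rw [disjoint_filter]
      rintro v - h rfl
      exact (hσ (σ.symm w)).2 (by simpa using h)

/-- A permutation with few cycles that contains the matching given by the involution `τ` (with
tails `A`) and otherwise follows `D`, avoiding the pairs in `Z`. -/
theorem exists_perm_through_matching {V : Type} [Fintype V] [DecidableEq V] {D Z : V → V → Prop}
    (hanti : ∀ v w, D v w → ¬ D w v) {τ : V → V} {A : Finset V} (hτ : ∀ v, τ (τ v) = v)
    (hA : ∀ v ∈ A, τ v ∉ A) (hA' : ∀ v ∉ A, τ v ≠ v → τ v ∈ A) (hτD : ∀ v, ¬ D v (τ v))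
    {t c d : ℕ} (hd : 1 ≤ d) (hcd : c + d ≤ t)
    (hZout : ∀ v, (univ.filter fun w => Z v w).card ≤ c)
    (hZin : ∀ w, (univ.filter fun v => Z v w).card ≤ c)
    (hexp : ∀ S T : Finset V, Disjoint S A → Disjoint T (A.image τ) →
      S.card + T.card + A.card = Fintype.card V + 1 → t * min S.card T.card < arcs D S T) :
    ∃ σ : Equiv.Perm V, (∀ v ∈ A, σ v = τ v) ∧ (∀ v ∉ A, D v (σ v) ∧ ¬ Z v (σ v)) ∧
      (∀ v, σ v ≠ v) ∧ (∀ v, σ (σ v) ≠ v) ∧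
      Real.log ((invColourings σ).card) ≤ cycleBound (Fintype.card V) d := by
  have hτinj : Function.Injective τ := Function.LeftInverse.injective hτ
  let α := {v : V // v ∉ A}
  have hcα : Fintype.card α + A.card = Fintype.card V := by
    have h1 := Fintype.card_subtype_compl fun v => v ∈ A
    have h2 : A.card ≤ Fintype.card V := card_le_univ _
    rw [Fintype.card_coe] at h1
    have h3 : Fintype.card α = Fintype.card {v // ¬ v ∈ A} := rfl
    rw [h3, h1]
    omega
  let ι : α ↪ V := Function.Embedding.subtype _
  let κ : α ↪ V := ⟨fun u => τ u.1, fun a b h => Subtype.ext (hτinj h)⟩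
  obtain ⟨R, hRQ, hRout, hRin⟩ := exists_regular_subrelation (α := α) (t := t) (t₀ := c) (d := d)
    (R₀ := fun v u => D v.1 (τ u.1)) (Q := fun v u => D v.1 (τ u.1) ∧ ¬ Z v.1 (τ u.1)) (by
      intro S T hST
      have h := hexp (S.map ι) (T.map κ) (by
          rw [Finset.disjoint_left]
          intro v hv hvA
          obtain ⟨u, -, rfl⟩ := mem_map.1 hv
          exact u.2 hvA) (by
          rw [Finset.disjoint_left]
          intro v hv hvA
          obtain ⟨u, -, rfl⟩ := mem_map.1 hv
          obtain ⟨a, ha, hau⟩ := mem_image.1 hvA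
          exact u.2 (hτinj hau ▸ ha)) (by
          rw [card_map, card_map]; omega)
      rw [card_map, card_map] at h
      refine h.trans_le (le_of_eq ?_)
      rw [arcs, arcs, sum_map]
      refine sum_congr rfl fun v _ => ?_
      rw [filter_map, card_map]
      rfl) (by
      intro v
      refine le_trans (card_le_card_of_injOn (fun u => τ u.1) (fun u hu => ?_) ?_) (hZout v.1)
      · simp only [coe_filter, mem_univ, true_and, Set.mem_ofPred_eq] at hu ⊢
        tauto
      · exact fun a _ b _ h => Subtype.ext (hτinj h)) (by
      intro u
      refine le_trans (card_le_card_of_injOn (fun v => v.1) (fun v hv => ?_) ?_) (hZin (τ u.1))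
      · simp only [coe_filter, mem_univ, true_and, Set.mem_ofPred_eq] at hv ⊢
        tauto
      · exact fun a _ b _ h => Subtype.ext h) hcd
  obtain ⟨ρ, hρ, hlog⟩ := exists_perm_log_invColourings_le hd hRout hRin
  let σ : Equiv.Perm V := (Function.Involutive.toPerm τ hτ) * Equiv.Perm.ofSubtype ρ
  have hσA : ∀ v ∈ A, σ v = τ v := fun v hv => by
    simp only [σ, Equiv.Perm.mul_apply]
    rw [Equiv.Perm.ofSubtype_apply_of_not_mem ρ (not_not.2 hv)]
    rfl
  have hσα : ∀ v (hv : v ∉ A), σ v = τ (ρ ⟨v, hv⟩).1 := fun v hv => by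
    simp only [σ, Equiv.Perm.mul_apply]
    rw [Equiv.Perm.ofSubtype_apply_of_mem ρ hv]
    rfl
  have hσD : ∀ v ∉ A, D v (σ v) ∧ ¬ Z v (σ v) := fun v hv => by
    rw [hσα v hv]
    exact hRQ _ _ (hρ ⟨v, hv⟩)
  have hAne : ∀ v ∈ A, τ v ≠ v := fun v hv h => hA v hv (h.symm ▸ hv)
  refine ⟨σ, hσA, hσD, fun v h => ?_, fun v h => ?_, ?_⟩
  · by_cases hv : v ∈ A
    · rw [hσA v hv] at h
      exact hAne v hv h
    · have := (hσD v hv).1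
      rw [h] at this
      exact hanti _ _ this this
  · by_cases hv : v ∈ A
    · rw [hσA v hv] at h
      have := (hσD (τ v) (hA v hv)).1
      rw [h] at this
      exact hτD (τ v) (by rwa [hτ])
    · by_cases hv' : σ v ∈ A
      · rw [hσA _ hv'] at h
        have h1 : σ v = τ v := by rw [← hτ (σ v), h]
        exact hτD v (h1 ▸ (hσD v hv).1)
      · have := (hσD _ hv').1
        rw [h] at this
        exact hanti _ _ this (hσD v hv).1
  · have hle : (invColourings σ).card ≤ (invColourings ρ).card := by
      refine card_le_card_of_injOn (fun f v => f v.1) (fun f hf => ?_) (fun f hf g hg h => ?_)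
      · rw [mem_coe, invColourings, mem_filter] at hf ⊢
        refine ⟨mem_univ _, fun v => ?_⟩
        have h1 := hf.2 v.1
        rw [hσα v.1 v.2] at h1
        dsimp only
        rw [← h1]
        by_cases hu : τ (ρ v).1 = (ρ v).1
        · rw [hu]
        · have h2 := hA' _ (ρ v).2 hu
          have h3 := hf.2 (τ (ρ v).1)
          rw [hσA _ h2, hτ] at h3
          exact h3
      · rw [mem_coe, invColourings, mem_filter] at hf hg
        funext v
        by_cases hv : v ∈ A
        · rw [← hf.2 v, ← hg.2 v, hσA v hv]
          exact congrFun h ⟨τ v, hA v hv⟩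
        · exact congrFun h ⟨v, hv⟩
    have hpos : 0 < (invColourings σ).card :=
      card_pos.2 ⟨fun _ => false, by simp [invColourings]⟩
    have hdR : (0 : ℝ) < d := by exact_mod_cast hd
    calc Real.log ((invColourings σ).card) ≤ Real.log ((invColourings ρ).card) :=
          Real.log_le_log (by exact_mod_cast hpos) (by exact_mod_cast hle)
      _ ≤ _ := hlog
      _ ≤ _ := by
          rw [cycleBound]
          have h0 : 0 ≤ Real.log ((d : ℝ) + 1) := Real.log_nonneg (by linarith)
          have h1 : (Fintype.card α : ℝ) ≤ Fintype.card V := by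
            rw [← hcα]; push_cast; linarith [show (0 : ℝ) ≤ A.card by positivity]
          gcongr

end MatchingContraction

section BadPhase

open Finset

theorem exists_involution_of_matching {V : Type} [DecidableEq V] (M : Finset (Sym2 V))
    (hM : ∀ e ∈ M, ¬ e.IsDiag) (hm : ∀ e ∈ M, ∀ f ∈ M, e ≠ f → ∀ v, v ∈ e → v ∉ f) :
    ∃ (τ : V → V) (A : Finset V), (∀ v, τ (τ v) = v) ∧ (∀ v ∈ A, τ v ∉ A) ∧
      (∀ v ∉ A, τ v ≠ v → τ v ∈ A) ∧ A.card ≤ M.card ∧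
      (∀ v, τ v ≠ v → s(v, τ v) ∈ M) ∧ ∀ e ∈ M, ∃ v ∈ A, e = s(v, τ v) := by
  let τ : V → V := fun v => if h : ∃ e ∈ M, v ∈ e then Sym2.Mem.other h.choose_spec.2 else v
  have hτe : ∀ v, ∀ e ∈ M, v ∈ e → s(v, τ v) = e := by
    intro v e he hv
    have h : ∃ e ∈ M, v ∈ e := ⟨e, he, hv⟩
    simp only [τ, dif_pos h]
    rw [Sym2.other_spec]
    by_contra hne
    exact hm _ h.choose_spec.1 e he hne v h.choose_spec.2 hv
  have hcov : ∀ v, τ v ≠ v → ∃ e ∈ M, v ∈ e := by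
    intro v hv
    by_contra h
    exact hv (by simp only [τ, dif_neg h])
  have hττ : ∀ v, τ (τ v) = v := by
    intro v
    by_cases hv : τ v = v
    · rw [hv, hv]
    · obtain ⟨e, he, hve⟩ := hcov v hv
      have h1 := hτe v e he hve
      have h2 := hτe (τ v) e he (h1 ▸ Sym2.mem_mk_right _ _)
      rw [← h1, Sym2.eq_swap (a := v)] at h2
      exact Sym2.congr_right.1 h2
  have ht : ∀ e : Sym2 V, (Quot.out e).1 ∈ e := fun e => Sym2.out_fst_mem e
  refine ⟨τ, M.image fun e => (Quot.out e).1, hττ, fun v hv hv' => ?_, fun v hv hne => ?_,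
    card_image_le, fun v hv => ?_, fun e he => ⟨_, mem_image_of_mem _ he, ?_⟩⟩
  · obtain ⟨e, he, rfl⟩ := mem_image.1 hv
    obtain ⟨e', he', h⟩ := mem_image.1 hv'
    have h1 := hτe _ e he (ht e)
    have heq : e = e' := by
      by_contra hne
      have h2 : τ (Quot.out e).1 ∈ s((Quot.out e).1, τ (Quot.out e).1) := Sym2.mem_mk_right _ _
      exact hm e he e' he' hne (τ (Quot.out e).1) (by rwa [h1] at h2) (h ▸ ht e')
    subst heq
    rw [← h] at h1
    exact hM e he (h1 ▸ rfl)
  · obtain ⟨e, he, hve⟩ := hcov v hne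
    have h1 := hτe v e he hve
    have h2 := ht e
    rw [mem_image]
    refine ⟨e, he, ?_⟩
    have h3 : (Quot.out e).1 ∈ s(v, τ v) := h1.symm ▸ h2
    rcases Sym2.mem_iff.1 h3 with h | h
    · exact absurd (mem_image.2 ⟨e, he, h⟩) hv
    · exact h
  · obtain ⟨e, he, hve⟩ := hcov v hv
    rw [hτe v e he hve]
    exact he
  · exact (hτe _ e he (ht e)).symm

theorem mem_edgeSet_permGraph {V : Type} {σ : Equiv.Perm V} (h : ∀ v, σ v ≠ v) {e : Sym2 V} :
    e ∈ (permGraph σ).edgeSet ↔ ∃ v, e = s(v, σ v) := by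
  constructor
  · induction e using Sym2.ind with
    | _ a b =>
      rintro ⟨-, h | h⟩
      · exact ⟨a, by rw [h]⟩
      · exact ⟨b, by rw [h]; exact Sym2.eq_swap⟩
  · rintro ⟨v, rfl⟩
    exact ⟨(h v).symm, Or.inl rfl⟩

/-- Every colour class of the matching-coloured set `E` is put into a 2-factor of its own, whose
remaining edges come from `H`. -/
theorem exists_twoFactors_through_matchings {V : Type} [Fintype V] [DecidableEq V]
    {H H' : SimpleGraph V} {D : V → V → Prop} {d₀ K d t : ℕ} (hD : IsBalancedOrientation H d₀ D)
    (hHH' : ∀ v w, H.Adj v w → ¬ H'.Adj v w) {E : Finset (Sym2 V)}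
    (hE : ∀ e ∈ E, e ∈ H'.edgeSet) (c : Sym2 V → Fin K)
    (hc : ∀ e ∈ E, ∀ f ∈ E, e ≠ f → c e = c f → ∀ v, v ∈ e → v ∉ f)
    (hd : 1 ≤ d) (hKd : K + d ≤ t)
    (hexp : ∀ γ (A B S T : Finset V), A ⊆ colourSupport E c γ → B ⊆ colourSupport E c γ →
      A.card = B.card → A.card ≤ (E.filter fun e => c e = γ).card → Disjoint S A → Disjoint T B →
      S.card + T.card + A.card = Fintype.card V + 1 → t * min S.card T.card < arcs D S T) :
    ∃ F : ℕ → SimpleGraph V, (∀ i < K, F i ≤ H ⊔ H' ∧ ∀ v, deg (F i) v = 2) ∧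
      (∀ i < K, ∀ j < K, i ≠ j → Disjoint (F i).edgeSet (F j).edgeSet) ∧
      (∀ i < K, ∀ e ∈ E, e ∈ (F i).edgeSet ↔ (c e : ℕ) = i) ∧
      ∀ i < K, numCycles (F i) * Real.log 2 ≤ cycleBound (Fintype.card V) d := by
  have hloop : ∀ v, ¬ D v v := fun v h => hD.antisymm v v h h
  have main : ∀ k ≤ K, ∃ σ : ℕ → Equiv.Perm V,
      (∀ i < k, (∀ v, D v (σ i v) ∨ s(v, σ i v) ∈ E ∧ (c s(v, σ i v) : ℕ) = i) ∧
        (∀ e ∈ E, (c e : ℕ) = i → ∃ v, e = s(v, σ i v)) ∧ (∀ v, σ i v ≠ v) ∧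
        (∀ v, σ i (σ i v) ≠ v) ∧
        Real.log ((invColourings (σ i)).card) ≤ cycleBound (Fintype.card V) d) ∧
      ∀ i < k, ∀ j < k, i ≠ j → ∀ v, D v (σ i v) → σ i v ≠ σ j v := by
    intro k hk
    induction k with
    | zero => exact ⟨fun _ => 1, by simp, by simp⟩
    | succ k ih =>
      obtain ⟨σ, h1, h2⟩ := ih (by omega)
      set γ : Fin K := ⟨k, by omega⟩ with hγ
      obtain ⟨τ, A, hτ, hA, hA', hAc, hτM, hMA⟩ := exists_involution_of_matching
        (E.filter fun e => c e = γ)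
        (fun e he => H'.not_isDiag_of_mem_edgeSet (hE e (mem_filter.1 he).1))
        (fun e he f hf hne => hc e (mem_filter.1 he).1 f (mem_filter.1 hf).1 hne
          ((mem_filter.1 he).2.trans (mem_filter.1 hf).2.symm))
      have hAne : ∀ v ∈ A, τ v ≠ v := fun v hv h => hA v hv (h.symm ▸ hv)
      have hτinj : Function.Injective τ := Function.LeftInverse.injective hτ
      have hDE : ∀ v w, D v w → s(v, w) ∉ E := fun v w h he =>
        hHH' v w ((hD.adj_iff v w).2 (Or.inl h)) (hE _ he)
      obtain ⟨Z, hZ⟩ : ∃ Z : V → V → Prop, ∀ v w, Z v w ↔ ∃ j < k, σ j v = w :=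
        ⟨_, fun _ _ => Iff.rfl⟩
      obtain ⟨ρ, hρA, hρD, hρ1, hρ2, hρc⟩ := exists_perm_through_matching (D := D) (Z := Z)
        (t := t) (c := k) hD.antisymm hτ hA hA'
        (fun v h => by
          by_cases hv : τ v = v
          · rw [hv] at h; exact hloop v h
          · exact hDE _ _ h (mem_filter.1 (hτM v hv)).1)
        hd (by omega)
        (fun v => by
          refine (card_le_card (t := (range k).image fun j => σ j v) fun w hw => ?_).trans
            (card_image_le.trans (card_range k).le)
          obtain ⟨j, hj, h⟩ := (hZ v w).1 (mem_filter.1 hw).2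
          exact mem_image.2 ⟨j, mem_range.2 hj, h⟩)
        (fun w => by
          refine (card_le_card (t := (range k).image fun j => (σ j).symm w) fun v hv => ?_).trans
            (card_image_le.trans (card_range k).le)
          obtain ⟨j, hj, h⟩ := (hZ v w).1 (mem_filter.1 hv).2
          exact mem_image.2 ⟨j, mem_range.2 hj, by rw [← h]; simp⟩)
        (fun S T hS hT hST => hexp γ A (A.image τ) S T
          (fun v hv => by
            have := mem_filter.1 (hτM v (hAne v hv))
            exact mem_colourSupport.2 ⟨_, this.1, this.2, Sym2.mem_mk_left _ _⟩)
          (fun u hu => by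
            obtain ⟨v, hv, rfl⟩ := mem_image.1 hu
            have := mem_filter.1 (hτM v (hAne v hv))
            exact mem_colourSupport.2 ⟨_, this.1, this.2, Sym2.mem_mk_right _ _⟩)
          (card_image_of_injective _ hτinj).symm hAc hS hT hST)
      have hupd : ∀ i < k, Function.update σ k ρ i = σ i := fun i hi =>
        Function.update_of_ne hi.ne _ _
      have hfresh : ∀ j < k, ∀ v, D v (ρ v) → ρ v ≠ σ j v := by
        intro j hj v hDv h
        by_cases hv : v ∈ A
        · rw [hρA v hv] at hDv
          exact hDE _ _ hDv (mem_filter.1 (hτM v (hAne v hv))).1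
        · exact (hρD v hv).2 ((hZ _ _).2 ⟨j, hj, h.symm⟩)
      refine ⟨Function.update σ k ρ, fun i hi => ?_, fun i hi j hj hij v hDv => ?_⟩
      · rcases Nat.lt_succ_iff_lt_or_eq.1 hi with hi | rfl
        · rw [hupd i hi]; exact h1 i hi
        · rw [Function.update_self]
          refine ⟨fun v => ?_, fun e he hce => ?_, hρ1, hρ2, hρc⟩
          · by_cases hv : v ∈ A
            · right
              rw [hρA v hv]
              have := mem_filter.1 (hτM v (hAne v hv))
              exact ⟨this.1, by rw [this.2]⟩
            · exact Or.inl (hρD v hv).1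
          · obtain ⟨v, hv, h⟩ := hMA e (mem_filter.2 ⟨he, Fin.ext hce⟩)
            exact ⟨v, by rw [hρA v hv]; exact h⟩
      · rcases Nat.lt_succ_iff_lt_or_eq.1 hi with hi | rfl
        · rw [hupd i hi] at hDv ⊢
          rcases Nat.lt_succ_iff_lt_or_eq.1 hj with hj | rfl
          · rw [hupd j hj]; exact h2 i hi j hj hij v hDv
          · rw [Function.update_self]
            intro h
            rw [h] at hDv
            exact hfresh i hi v hDv h.symm
        · rw [Function.update_self] at hDv ⊢
          have hj : j < i := by omega
          rw [hupd j hj]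
          exact hfresh j hj v hDv
  obtain ⟨σ, h1, h2⟩ := main K le_rfl
  refine ⟨fun i => permGraph (σ i), fun i hi => ?_, fun i hi j hj hij => ?_, fun i hi e he => ?_,
    fun i hi => (numCycles_permGraph_mul_log_le _).trans (h1 i hi).2.2.2.2⟩
  · obtain ⟨ha, -, hb, hb', -⟩ := h1 i hi
    refine ⟨?_, fun v => deg_permGraph (hb v) (hb' v)⟩
    rw [← edgeSet_subset_edgeSet]
    intro e he
    obtain ⟨v, rfl⟩ := (mem_edgeSet_permGraph hb).1 he
    rcases ha v with h | h
    · exact Or.inl ((hD.adj_iff _ _).2 (Or.inl h))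
    · exact Or.inr (hE _ h.1)
  · obtain ⟨ha, -, hb, -⟩ := h1 i hi
    obtain ⟨ha', -, hb', -⟩ := h1 j hj
    rw [Set.disjoint_left]
    intro e he he'
    obtain ⟨v, rfl⟩ := (mem_edgeSet_permGraph hb).1 he
    obtain ⟨w, hw⟩ := (mem_edgeSet_permGraph hb').1 he'
    rcases ha v with h | h <;> rcases ha' w with h' | h'
    · rcases Sym2.eq_iff.1 hw with ⟨rfl, h3⟩ | ⟨h3, h4⟩
      · exact h2 i hi j hj hij v h h3
      · rw [← h3, ← h4] at h'
        exact hD.antisymm _ _ h h'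
    · rw [← hw] at h'
      exact hHH' _ _ ((hD.adj_iff _ _).2 (Or.inl h)) (hE _ h'.1)
    · rw [hw] at h
      exact hHH' _ _ ((hD.adj_iff _ _).2 (Or.inl h')) (hE _ h.1)
    · rw [← hw] at h'
      exact hij (h.2.symm.trans h'.2)
  · obtain ⟨ha, ha', hb, -⟩ := h1 i hi
    rw [mem_edgeSet_permGraph hb]
    constructor
    · rintro ⟨v, rfl⟩
      rcases ha v with h | h
      · exact absurd (hE _ he) (hHH' _ _ ((hD.adj_iff _ _).2 (Or.inl h)))
      · exact h.2
    · exact ha' e he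

end BadPhase

section Assembly

open Finset

/-- Edge-disjoint 2-factors of a regular graph of even degree extend to a 2-factorization. -/
theorem exists_twoFactorization_extending {V : Type} [Fintype V] [DecidableEq V]
    {G : SimpleGraph V} {K m : ℕ} (hKm : K ≤ m) (hG : ∀ v, deg G v = 2 * m)
    {F : ℕ → SimpleGraph V} (hF : ∀ i < K, F i ≤ G ∧ ∀ v, deg (F i) v = 2)
    (hdisj : ∀ i < K, ∀ j < K, i ≠ j → Disjoint (F i).edgeSet (F j).edgeSet) :
    ∃ F' : ℕ → SimpleGraph V, (∀ i < K, F' i = F i) ∧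
      (∀ i < m, F' i ≤ G ∧ ∀ v, deg (F' i) v = 2) ∧
      (∀ i < m, ∀ j < m, i ≠ j → Disjoint (F' i).edgeSet (F' j).edgeSet) ∧
      (∀ v w, G.Adj v w → ∃ i < m, (F' i).Adj v w) ∧
      ∑ i ∈ range m, numCycles (F' i) * Real.log 2 ≤
        ∑ i ∈ range K, numCycles (F i) * Real.log 2 +
          ∑ i ∈ range (m - K), cycleBound (Fintype.card V) (i + 1) := by
  have hres : ∀ k ≤ K, ∃ R ≤ G, (∀ v, deg R v = 2 * (m - k)) ∧
      ∀ v w, R.Adj v w ↔ G.Adj v w ∧ ∀ i < k, ¬ (F i).Adj v w := by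
    intro k hk
    induction k with
    | zero => exact ⟨G, le_rfl, hG, by simp⟩
    | succ k ih =>
      obtain ⟨R, hRG, hRdeg, hR⟩ := ih (by omega)
      have hle : F k ≤ R := fun v w h => (hR v w).2 ⟨(hF k (by omega)).1 h, fun i hi h' =>
        Set.disjoint_left.1 (hdisj i (by omega) k (by omega) hi.ne)
          (show s(v, w) ∈ (F i).edgeSet from h') h⟩
      refine ⟨R \ F k, sdiff_le.trans hRG, fun v => ?_, fun v w => ?_⟩
      · rw [deg_sdiff hle, hRdeg, (hF k (by omega)).2]
        omega
      · rw [SimpleGraph.sdiff_adj, hR]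
        constructor
        · rintro ⟨⟨h1, h2⟩, h3⟩
          refine ⟨h1, fun i hi => ?_⟩
          rcases Nat.lt_succ_iff_lt_or_eq.1 hi with hi | rfl
          · exact h2 i hi
          · exact h3
        · rintro ⟨h1, h2⟩
          exact ⟨⟨h1, fun i hi => h2 i (by omega)⟩, h2 k (by omega)⟩
  obtain ⟨R, hRG, hRdeg, hR⟩ := hres K le_rfl
  obtain ⟨F₂, h1, h2, h3, h4⟩ := exists_twoFactorization R hRdeg
  have hcross : ∀ i < K, ∀ j < m - K, Disjoint (F i).edgeSet (F₂ j).edgeSet := by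
    intro i hi j hj
    rw [Set.disjoint_left]
    intro e
    induction e using Sym2.ind with
    | _ a b => exact fun h h' => ((hR a b).1 ((h1 j hj).1 h')).2 i hi h
  refine ⟨fun i => if i < K then F i else F₂ (i - K), fun i hi => if_pos hi, fun i hi => ?_,
    fun i hi j hj hij => ?_, fun v w hvw => ?_, ?_⟩
  · dsimp only
    split_ifs with h
    · exact hF i h
    · exact ⟨(h1 _ (by omega)).1.trans hRG, (h1 _ (by omega)).2⟩
  · dsimp only
    split_ifs with h h' h'
    · exact hdisj i h j h' hij
    · exact hcross i h _ (by omega)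
    · exact (hcross j h' _ (by omega)).symm
    · exact h2 _ (by omega) _ (by omega) (by omega)
  · by_cases h : ∃ i < K, (F i).Adj v w
    · obtain ⟨i, hi, h⟩ := h
      exact ⟨i, by omega, by simpa only [if_pos hi] using h⟩
    · push Not at h
      obtain ⟨i, hi, h'⟩ := h3 v w ((hR v w).2 ⟨hvw, h⟩)
      exact ⟨K + i, by omega, by simpa using h'⟩
  · have hm : m = K + (m - K) := by omega
    conv_lhs => rw [hm, sum_range_add]
    refine add_le_add (sum_le_sum fun i hi => ?_) ((sum_le_sum fun i _ => ?_).trans h4)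
    · simp only [if_pos (mem_range.1 hi), le_refl]
    · simp

theorem mul_min_card_lt_arcs {V : Type} [Fintype V] [DecidableEq V] {G : SimpleGraph V}
    {D : V → V → Prop} {d t : ℕ} {r : ℝ} (hr : 0 < r) (hn : 10 ^ 4 ≤ Fintype.card V)
    (hDG : ∀ v w, D v w → G.Adj v w) (hanti : ∀ v w, D v w → ¬ D w v)
    (hout : ∀ v, (univ.filter fun w => D v w).card = d)
    (hin : ∀ w, (univ.filter fun v => D v w).card = d)
    (hdeg : ∀ v, (deg G v : ℝ) ≤ 2 * d + r / 1000) (hd : 999 / 1000 * r ≤ 2 * d)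
    (hup : ∀ U : Finset V, (arcs G.Adj U U : ℝ) ≤
      r / Fintype.card V * (U.card : ℝ) ^ 2 + r / 500 * U.card)
    (hlow : ∀ U : Finset V, r / Fintype.card V * ((U.card : ℝ) * (U.card - 1)) - r / 500 * U.card ≤
      arcs G.Adj U U) (ht : (t : ℝ) ≤ r / 100)
    {S T A B : Finset V} (hSA : Disjoint S A) (hTB : Disjoint T B) (hAB : A.card = B.card)
    (hA : (A.card : ℝ) ≤ Fintype.card V / 10 ^ 6)
    (hST : S.card + T.card + A.card = Fintype.card V + 1)
    (hAD : ∀ w, ((A.filter fun v => D v w).card : ℝ) ≤ 9 / 100 * r)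
    (hBD : ∀ v, ((B.filter fun w => D v w).card : ℝ) ≤ 9 / 100 * r) :
    t * min S.card T.card < arcs D S T := by
  have key : (t : ℝ) * min S.card T.card < arcs D S T := by
    rcases le_total S.card T.card with h | h
    · rw [min_eq_left (by exact_mod_cast h)]
      have := arcs_gt hr hn hDG hanti hout hin hdeg hd hup hlow hTB (hAB ▸ hA) (hAB ▸ hST) h hBD
      exact (mul_le_mul_of_nonneg_right ht (Nat.cast_nonneg _)).trans_lt this
    · rw [min_eq_right (by exact_mod_cast h), ← arcs_swap]
      have := arcs_gt (D := fun v w => D w v) hr hn (fun v w hvw => (hDG w v hvw).symm)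
        (fun v w => hanti w v) hin hout hdeg hd hup hlow hSA hA (by omega) h hAD
      exact (mul_le_mul_of_nonneg_right ht (Nat.cast_nonneg _)).trans_lt this
  exact_mod_cast key

theorem two_mul_eIn {V : Type} [Fintype V] [DecidableEq V] (G : SimpleGraph V) (U : Finset V) :
    2 * eIn G U = arcs G.Adj U U := by
  have h1 : eIn G U = (G.edgeFinset.filter fun e => ∀ v ∈ e, v ∈ U).card := by
    rw [eIn, ← Set.ncard_coe_finset]
    congr 1
    ext e
    simp
  have h2 : arcs G.Adj U U = ((univ : Finset G.Dart).filter
      fun a => a.edge ∈ G.edgeFinset.filter fun e => ∀ v ∈ e, v ∈ U).card := by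
    rw [arcs, ← card_sigma]
    symm
    refine card_bij (fun a _ => ⟨a.fst, a.snd⟩) (fun a ha => ?_) (fun a _ b _ h => ?_)
      (fun x hx => ?_)
    · have := (mem_filter.1 (mem_filter.1 ha).2).2
      rw [mem_sigma, mem_filter]
      exact ⟨this _ (Sym2.mem_mk_left _ _), this _ (Sym2.mem_mk_right _ _), a.adj⟩
    · ext
      · exact congrArg Sigma.fst h
      · simp only [Sigma.mk.injEq, heq_eq_eq] at h
        exact h.2
    · rw [mem_sigma, mem_filter] at hx
      refine ⟨⟨(x.1, x.2), hx.2.2⟩, ?_, rfl⟩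
      simp [Dart.edge, hx.1, hx.2.1]
  rw [h1, h2]
  generalize hM : G.edgeFinset.filter (fun e => ∀ v ∈ e, v ∈ U) = M
  have hfib : Set.MapsTo (Dart.edge (G := G)) ((univ.filter fun a : G.Dart => a.edge ∈ M : Finset _) :
      Set G.Dart) M := fun a ha => (mem_filter.1 (mem_coe.1 ha)).2
  rw [card_eq_sum_card_fiberwise hfib, sum_const_nat (m := 2), mul_comm]
  subst hM
  intro e he
  rw [← G.dart_edge_fiber_card e (mem_edgeFinset.1 (mem_filter.1 he).1)]
  congr 1
  ext a
  simp only [mem_filter, mem_univ, true_and]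
  constructor
  · rintro ⟨-, h⟩; exact h
  · rintro rfl
    exact ⟨mem_filter.1 he, rfl⟩

theorem deg_le_maxDeg {V : Type} [Finite V] (G : SimpleGraph V) (v : V) : deg G v ≤ maxDeg G :=
  le_csSup (Set.finite_range _).bddAbove ⟨v, rfl⟩

theorem minDeg_lt {V : Type} [Fintype V] [DecidableEq V] [Nonempty V] (G : SimpleGraph V) :
    minDeg G < Fintype.card V := by
  obtain ⟨v⟩ := ‹Nonempty V›
  refine (show minDeg G ≤ deg G v from Nat.sInf_le ⟨v, rfl⟩).trans_lt ?_
  rw [deg_eq_card_filter]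
  refine card_lt_univ_of_notMem (x := v) ?_
  simp

theorem deg_sup {V : Type} [Finite V] {H H' : SimpleGraph V}
    (h : Disjoint H.edgeSet H'.edgeSet) (v : V) : deg (H ⊔ H') v = deg H v + deg H' v := by
  rw [deg, deg, deg, ← Set.ncard_union_eq _ (Set.toFinite _) (Set.toFinite _)]
  · rfl
  · rw [Set.disjoint_left]
    exact fun w hw hw' => Set.disjoint_left.1 h (show s(v, w) ∈ H.edgeSet from hw) hw'

theorem card_filter_mem_le_deg {V : Type} [Fintype V] [DecidableEq V] {H : SimpleGraph V}
    {E : Finset (Sym2 V)} (hE : ∀ e ∈ E, e ∈ H.edgeSet) (v : V) :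
    (E.filter fun e => v ∈ e).card ≤ deg H v := by
  rw [deg_eq_card_filter]
  refine (card_le_card (t := (univ.filter fun w => H.Adj v w).image fun w => s(v, w))
    fun e he => ?_).trans card_image_le
  obtain ⟨h1, h2⟩ := mem_filter.1 he
  obtain ⟨w, rfl⟩ := h2
  exact mem_image.2 ⟨w, mem_filter.2 ⟨mem_univ _, hE _ h1⟩, rfl⟩

end Assembly

section SpreadFactorization

open Finset

/-- If `H` has expanding balanced orientations and `E` is a sparse set of edges of `H'`, then
`H ⊔ H'` has a 2-factorization with few cycles, each member of which meets `E` in a small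
matching. -/
theorem exists_twoFactorization_spreading {V : Type} [Fintype V] [DecidableEq V]
    {G H H' : SimpleGraph V} {d₀ d₁ K d t μ B : ℕ} {r : ℝ} (hr : 0 < r)
    (hn : 10 ^ 4 ≤ Fintype.card V) (hHG : H ≤ G) (hH : ∀ v, deg H v = 2 * d₀)
    (hH' : ∀ v, deg H' v = 2 * d₁) (hdisj : Disjoint H.edgeSet H'.edgeSet)
    (hdeg : ∀ v, (deg G v : ℝ) ≤ 2 * d₀ + r / 1000) (hd₀ : 999 / 1000 * r ≤ 2 * d₀)
    (hup : ∀ U : Finset V, (arcs G.Adj U U : ℝ) ≤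
      r / Fintype.card V * (U.card : ℝ) ^ 2 + r / 500 * U.card)
    (hlow : ∀ U : Finset V, r / Fintype.card V * ((U.card : ℝ) * (U.card - 1)) - r / 500 * U.card ≤
      arcs G.Adj U U) (ht : (t : ℝ) ≤ r / 100) (hd : 1 ≤ d) (hKd : K + d ≤ t)
    (hKm : K ≤ d₀ + d₁) (hμ : 0 < μ) (hμn : (μ : ℝ) ≤ Fintype.card V / 10 ^ 6) (hK : 0 < K)
    (hKB : 4 * (2 * (2 * d₁) + B) ≤ K) {E : Finset (Sym2 V)} (hE : ∀ e ∈ E, e ∈ H'.edgeSet)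
    (hcard : E.card ≤ μ * B)
    (hlog : Real.log ((Fintype.card V * 2 : ℕ) * K) + 2 * d₀ * (2 * d₁ : ℕ) / K ≤
      9 / 100 * r * Real.log 2) :
    ∃ F : ℕ → SimpleGraph V, (∀ i < d₀ + d₁, F i ≤ H ⊔ H' ∧ ∀ v, deg (F i) v = 2) ∧
      (∀ i < d₀ + d₁, ∀ j < d₀ + d₁, i ≠ j → Disjoint (F i).edgeSet (F j).edgeSet) ∧
      (∀ v w, (H ⊔ H').Adj v w → ∃ i < d₀ + d₁, (F i).Adj v w) ∧
      (∑ i ∈ range (d₀ + d₁), (numCycles (F i) : ℝ)) * Real.log 2 ≤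
        K * cycleBound (Fintype.card V) d +
          ∑ i ∈ range (d₀ + d₁ - K), cycleBound (Fintype.card V) (i + 1) ∧
      ∀ i < d₀ + d₁, (∀ e ∈ E, e ∈ (F i).edgeSet → ∀ f ∈ E, f ∈ (F i).edgeSet → e ≠ f →
        ∀ v, v ∈ e → v ∉ f) ∧ (E.filter fun e => e ∈ (F i).edgeSet).card ≤ μ := by
  have hlog2 : 0 < Real.log 2 := Real.log_pos one_lt_two
  obtain ⟨D, hD⟩ := exists_balancedOrientation H hH
  obtain ⟨X, hXt, hXf⟩ : ∃ X : V × Bool → Finset V,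
      (∀ v, X (v, true) = univ.filter fun w => D v w) ∧
        ∀ w, X (w, false) = univ.filter fun v => D v w :=
    ⟨fun x => bif x.2 then univ.filter fun w => D x.1 w else univ.filter fun w => D w x.1,
      fun _ => rfl, fun _ => rfl⟩
  obtain ⟨c, hc1, hc2, hc3⟩ := exists_colouring_spread_on_sets hμ hK hKB X (d := d₀)
    (fun x => by
      obtain ⟨v, _ | _⟩ := x
      · rw [hXf, hD.into]
      · rw [hXt, hD.out]) E
    (fun e he => H'.not_isDiag_of_mem_edgeSet (hE e he))
    (fun v => (card_filter_mem_le_deg hE v).trans (hH' v).le) hcard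
  have hc4 : ∀ x γ, ((X x ∩ colourSupport E c γ).card : ℝ) ≤ 9 / 100 * r := by
    intro x γ
    have h := hc3 x γ
    rw [Fintype.card_prod, Fintype.card_bool] at h
    exact le_of_mul_le_mul_right (h.trans hlog) hlog2
  have hHH' : ∀ v w, H.Adj v w → ¬ H'.Adj v w := fun v w h h' =>
    Set.disjoint_left.1 hdisj (show s(v, w) ∈ H.edgeSet from h) h'
  obtain ⟨F, hF1, hF2, hF3, hF4⟩ := exists_twoFactors_through_matchings hD hHH' hE c hc1 hd hKd
    (fun γ A B S T hA hB hAB hAc hSA hTB hST => by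
      refine mul_min_card_lt_arcs hr hn (fun v w h => hHG ((hD.adj_iff v w).2 (Or.inl h)))
        hD.antisymm hD.out hD.into hdeg hd₀ hup hlow ht hSA hTB hAB
        (le_trans (by exact_mod_cast hAc.trans (hc2 γ)) hμn) hST (fun w => ?_) (fun v => ?_)
      · refine le_trans ?_ (hc4 (w, false) γ)
        gcongr
        intro v hv
        rw [mem_filter] at hv
        rw [hXf, mem_inter, mem_filter]
        exact ⟨⟨mem_univ _, hv.2⟩, hA hv.1⟩
      · refine le_trans ?_ (hc4 (v, true) γ)
        gcongr
        intro w hw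
        rw [mem_filter] at hw
        rw [hXt, mem_inter, mem_filter]
        exact ⟨⟨mem_univ _, hw.2⟩, hB hw.1⟩)
  obtain ⟨F', h1, h2, h3, h4, h5⟩ := exists_twoFactorization_extending hKm
    (fun v => by rw [deg_sup hdisj, hH, hH']; ring) hF1 hF2
  have hbad : ∀ i < d₀ + d₁, ∀ e ∈ E, e ∈ (F' i).edgeSet → (c e : ℕ) = i := by
    intro i hi e he hei
    by_contra hne
    have hmem : e ∈ (F' (c e)).edgeSet := by
      rw [h1 _ (c e).2]
      exact (hF3 _ (c e).2 e he).2 rfl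
    exact Set.disjoint_left.1 (h3 _ ((c e).2.trans_le hKm) i hi hne) hmem hei
  refine ⟨F', h2, h3, h4, ?_, fun i hi => ⟨fun e he hei f hf hfi hne => ?_, ?_⟩⟩
  · rw [sum_mul]
    refine h5.trans (add_le_add_left ?_ _)
    refine (sum_le_sum fun i hi => hF4 i (mem_range.1 hi)).trans ?_
    rw [sum_const, card_range, nsmul_eq_mul]
  · exact hc1 e he f hf hne (Fin.ext ((hbad i hi e he hei).trans (hbad i hi f hf hfi).symm))
  · by_cases hiK : i < K
    · refine (card_le_card fun e he => ?_).trans (hc2 ⟨i, hiK⟩)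
      rw [mem_filter] at he ⊢
      exact ⟨he.1, Fin.ext (hbad i hi e he.1 he.2)⟩
    · rw [filter_eq_empty_iff.2 fun e he hei => hiK ((hbad i hi e he hei) ▸ (c e).2)]
      simp

end SpreadFactorization

section Estimates

open Finset

theorem cycleBound_le {n k : ℕ} (hk : k ≤ n) (hn : 0 < n) :
    cycleBound n k ≤ n * (2 * Real.log n + 3) * (k : ℝ)⁻¹ := by
  have h1 : Real.log (k + 1) ≤ Real.log n + 1 := by
    have hn1 : (1 : ℝ) ≤ n := by exact_mod_cast hn
    have hk1 : (k : ℝ) ≤ n := by exact_mod_cast hk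
    have he := Real.exp_one_gt_d9
    rw [Real.log_le_iff_le_exp (by positivity), Real.exp_add, Real.exp_log (by linarith)]
    nlinarith
  calc cycleBound n k = n * (2 * Real.log (k + 1) + 1) * (k : ℝ)⁻¹ := by rw [cycleBound]; ring
    _ ≤ n * (2 * Real.log n + 3) * (k : ℝ)⁻¹ := by gcongr n * ?_ * _; linarith

theorem total_cycleBound_le {n K d m : ℕ} (hn : 0 < n) (hd : d ≤ n) (hd0 : 0 < d) (hK : K ≤ 5 * d)
    (hm : m ≤ n) :
    K * cycleBound n d + ∑ i ∈ range m, cycleBound n (i + 1) ≤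
      n * (2 * Real.log n + 3) * (6 + Real.log n) := by
  have hL : 0 ≤ Real.log n := Real.log_natCast_nonneg n
  have hd0' : (0 : ℝ) < d := by exact_mod_cast hd0
  have hK' : (K : ℝ) ≤ 5 * d := by exact_mod_cast hK
  have h1 : K * cycleBound n d ≤ n * (2 * Real.log n + 3) * 5 := by
    calc K * cycleBound n d ≤ (5 * d) * (n * (2 * Real.log n + 3) * (d : ℝ)⁻¹) := by
          gcongr
          · unfold cycleBound
            have := Real.log_nonneg (x := (d : ℝ) + 1) (by linarith)
            positivity
          · exact cycleBound_le hd hn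
      _ = _ := by field_simp
  have h2 : ∑ i ∈ range m, cycleBound n (i + 1) ≤
      n * (2 * Real.log n + 3) * (1 + Real.log n) := by
    calc ∑ i ∈ range m, cycleBound n (i + 1)
        ≤ ∑ i ∈ range m, n * (2 * Real.log n + 3) * ((i + 1 : ℕ) : ℝ)⁻¹ :=
          sum_le_sum fun i hi => cycleBound_le (by have := mem_range.1 hi; omega) hn
      _ = n * (2 * Real.log n + 3) * (harmonic m : ℝ) := by
          rw [← mul_sum, harmonic]
          push_cast
          rfl
      _ ≤ _ := by
          gcongr
          refine (harmonic_le_one_add_log m).trans ?_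
          rcases Nat.eq_zero_or_pos m with rfl | hm0
          · simpa using hL
          · gcongr
  calc _ ≤ n * (2 * Real.log n + 3) * 5 + n * (2 * Real.log n + 3) * (1 + Real.log n) :=
        add_le_add h1 h2
    _ = _ := by ring

theorem arcs_of_isJumbled {V : Type} [Fintype V] [DecidableEq V] {G : SimpleGraph V} {p β : ℝ}
    (h : IsJumbled G p β) (U : Finset V) :
    |(arcs G.Adj U U : ℝ) - p * (U.card * (U.card - 1))| ≤ 2 * β * U.card := by
  have h1 := h U
  rw [Set.ncard_coe_finset] at h1
  rw [← two_mul_eIn]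
  push_cast
  calc _ = 2 * |(eIn G U : ℝ) - p * ((U.card : ℝ) * ((U.card : ℝ) - 1) / 2)| := by
        rw [← abs_two, ← abs_mul, abs_two]
        congr 1
        ring
    _ ≤ 2 * (β * U.card) := by gcongr
    _ = _ := by ring

theorem log_add_le_of_le {n K b : ℕ} {a r : ℝ} (hL : 10 ^ 12 ≤ Real.log n)
    (hK : r / 250 ≤ K) (hKn : (K : ℝ) ≤ n) (hr : 2 * 10 ^ 12 * Real.log n ≤ r) (ha : a ≤ r)
    (hb : (2 * b : ℝ) ≤ r / 5000) :
    Real.log ((n * 2 : ℕ) * K) + a * (2 * b : ℕ) / K ≤ 9 / 100 * r * Real.log 2 := by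
  have hr0 : 0 < r := by linarith
  have hK0 : (0 : ℝ) < K := by linarith
  have hn0 : (0 : ℝ) < n := hK0.trans_le hKn
  have h1 : Real.log ((n * 2 : ℕ) * K) ≤ 3 * Real.log n := by
    have hn : (2 : ℝ) ≤ n := by
      have := Real.log_le_sub_one_of_pos hn0
      linarith
    rw [← Real.log_rpow hn0, show (3 : ℝ) = (3 : ℕ) by norm_num, Real.rpow_natCast]
    push_cast
    refine Real.log_le_log (by positivity) ?_
    calc (n * 2 * K : ℝ) ≤ n * n * n := by gcongr
      _ = _ := by ring
  have h2 : a * (2 * b : ℕ) / (K : ℝ) ≤ r / 20 := by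
    rw [div_le_iff₀ hK0]
    push_cast
    calc (a * (2 * b) : ℝ) ≤ r * (r / 5000) := by gcongr
      _ = r / 20 * (r / 250) := by ring
      _ ≤ _ := by gcongr
  have h3 := mul_le_mul_of_nonneg_left Real.log_two_gt_d9.le hr0.le
  linarith

theorem cycle_estimate {n L r : ℝ} (hn : 0 ≤ n) (hL : 10 ^ 12 ≤ L) (hr : 10 ^ 12 * L ≤ r) :
    n * (2 * L + 3) * (6 + L) ≤ 4 * n * √(r * L ^ 3) * Real.log 2 := by
  have hlog2 := Real.log_two_gt_d9
  have h1 : 10 ^ 6 * L ^ 2 ≤ √(r * L ^ 3) := by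
    refine Real.le_sqrt_of_sq_le ?_
    calc (10 ^ 6 * L ^ 2) ^ 2 = 10 ^ 12 * L * L ^ 3 := by ring
      _ ≤ r * L ^ 3 := by gcongr
  calc n * (2 * L + 3) * (6 + L) ≤ n * (5 * L) * (7 * L) := by gcongr <;> linarith
    _ ≤ 4 * n * (10 ^ 6 * L ^ 2) * (1 / 2) := by nlinarith [mul_nonneg hn (sq_nonneg L)]
    _ ≤ _ := by gcongr; linarith

end Estimates
end EDHC

open EDHC in
/-- Corollary 6.9 (Absorb2Fac). -/
theorem stmt_18 :
    ∃ N : ℕ, ∀ n : ℕ, N ≤ n →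
      ∀ (rG : ℝ) (G H H' : SimpleGraph (Fin n)) (rH rH' : ℕ) (Ebad : Set (Sym2 (Fin n))),
      IsPseudorandom n G (rG / n) → 2 * (Real.log n) ^ 2 ≤ rG →
      H ≤ G → (∀ v, deg H v = rH) → Even rH →
      (minDeg G : ℝ) - 1 ≤ (rH : ℝ) → (rH : ℝ) ≤ (minDeg G : ℝ) →
      (∀ v, deg H' v = rH') → Even rH' → Disjoint H.edgeSet H'.edgeSet →
      Ebad ⊆ H'.edgeSet →
      (rH' : ℝ) + 1 + 10 ^ 6 * (Ebad.ncard : ℝ) / n ≤ rG / 5000 →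
      ∃ F : Fin ((rH + rH') / 2) → SimpleGraph (Fin n),
        (∀ i, F i ≤ H ⊔ H' ∧ ∀ v, deg (F i) v = 2) ∧
        (∀ i j, i ≠ j → Disjoint (F i).edgeSet (F j).edgeSet) ∧
        (⨆ i, F i) = H ⊔ H' ∧
        (∑ i, (numCycles (F i) : ℝ)) ≤ 4 * (n : ℝ) * Real.sqrt (rG * (Real.log n) ^ 3) ∧
        (∀ i, IsMatchingSet ((F i).edgeSet ∩ Ebad) ∧
          ((((F i).edgeSet ∩ Ebad).ncard : ℝ)) ≤ (n : ℝ) / 10 ^ 6) := by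
  refine ⟨⌈Real.exp (10 ^ 12)⌉₊, fun n hN r G H H' rH rH' Ebad hG hr hHG hH hHe hrH hrH' hH' hHe'
    hdisj hbad hsmall => ?_⟩
  obtain ⟨d₀, rfl⟩ := hHe
  obtain ⟨d₁, rfl⟩ := hHe'
  rw [show (d₀ + d₀ + (d₁ + d₁)) / 2 = d₀ + d₁ by omega]
  have hexp : Real.exp (10 ^ 12) ≤ n := Nat.ceil_le.1 hN
  have hnR : (10 ^ 12 : ℝ) ≤ n := by linarith [Real.add_one_le_exp (10 ^ 12 : ℝ)]
  have hn0 : (0 : ℝ) < n := by linarith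
  have hn1 : 0 < n := by exact_mod_cast hn0
  have hnN : 10 ^ 12 ≤ n := by exact_mod_cast hnR
  have : Nonempty (Fin n) := ⟨⟨0, hn1⟩⟩
  have hL : (10 ^ 12 : ℝ) ≤ Real.log n := (Real.le_log_iff_exp_le hn0).2 hexp
  set L := Real.log n with hLdef
  have hrL : 2 * 10 ^ 12 * L ≤ r := by nlinarith
  have hr24 : (2 * 10 ^ 24 : ℝ) ≤ r := by linarith
  have hr0 : 0 < r := by linarith
  have hsL : √(r * L) ≤ r / 10 ^ 6 := by
    rw [Real.sqrt_le_left (by positivity)]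
    nlinarith
  have hnp : (n : ℝ) * (r / n) = r := by field_simp
  obtain ⟨hjum, -, -, ⟨hmin, hmin', hmax⟩, -⟩ := hG
  rw [hnp] at hjum hmin hmin' hmax
  have hsr : √(r * (1 - r / n)) ≤ r / 10 ^ 12 := by
    have : 0 ≤ r * (r / n) := by positivity
    rw [Real.sqrt_le_left (by positivity)]
    nlinarith
  have hsr0 := Real.sqrt_nonneg (r * (1 - r / n))
  have hminn : (minDeg G : ℝ) ≤ n := by
    have := minDeg_lt G
    rw [Fintype.card_fin] at this
    exact_mod_cast this.le
  push_cast at hrH hrH' hsmall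
  have hE0 : (0 : ℝ) ≤ 10 ^ 6 * (Ebad.ncard : ℝ) / n := by positivity
  have hjum' : ∀ U : Finset (Fin n),
      |(arcs G.Adj U U : ℝ) - r / n * (U.card * (U.card - 1))| ≤ r / 500 * U.card := fun U =>
    (arcs_of_isJumbled hjum U).trans (by gcongr; linarith)
  obtain ⟨K, hK, hK'⟩ : ∃ K : ℕ, r / 250 ≤ K ∧ (K : ℝ) < r / 250 + 1 :=
    ⟨⌈r / 250⌉₊, Nat.le_ceil _, Nat.ceil_lt_add_one (by positivity)⟩
  obtain ⟨d, hd, hd'⟩ : ∃ d : ℕ, r / 1000 ≤ d ∧ (d : ℝ) < r / 1000 + 1 :=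
    ⟨⌈r / 1000⌉₊, Nat.le_ceil _, Nat.ceil_lt_add_one (by positivity)⟩
  obtain ⟨t, ht, ht'⟩ : ∃ t : ℕ, (t : ℝ) ≤ r / 100 ∧ r / 100 < t + 1 :=
    ⟨⌊r / 100⌋₊, Nat.floor_le (by positivity), Nat.lt_floor_add_one _⟩
  obtain ⟨μ, hμ, hμ'⟩ : ∃ μ : ℕ, (μ : ℝ) ≤ n / 10 ^ 6 ∧ (n : ℝ) / 10 ^ 6 < μ + 1 :=
    ⟨⌊(n : ℝ) / 10 ^ 6⌋₊, Nat.floor_le (by positivity), Nat.lt_floor_add_one _⟩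
  have hμ0 : (0 : ℝ) < μ := by linarith
  obtain ⟨B, hB, hB'⟩ : ∃ B : ℕ, (Ebad.ncard : ℝ) / μ ≤ B ∧ (B : ℝ) < Ebad.ncard / μ + 1 :=
    ⟨⌈(Ebad.ncard : ℝ) / μ⌉₊, Nat.le_ceil _, Nat.ceil_lt_add_one (by positivity)⟩
  have hK0 : (0 : ℝ) < K := by linarith
  have hBμ : (Ebad.ncard : ℝ) / μ ≤ 2 * (10 ^ 6 * Ebad.ncard / n) := by
    rw [div_le_iff₀ hμ0]
    have : (1 : ℝ) ≤ 2 * (10 ^ 6 / n) * μ := by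
      rw [← mul_div_assoc, div_mul_eq_mul_div, le_div_iff₀ hn0]
      linarith
    calc (Ebad.ncard : ℝ) ≤ Ebad.ncard * (2 * (10 ^ 6 / n) * μ) :=
          le_mul_of_one_le_right (by positivity) this
      _ = _ := by ring
  have hd₁ : (0 : ℝ) ≤ d₁ := Nat.cast_nonneg _
  have hB0 : (0 : ℝ) ≤ B := Nat.cast_nonneg _
  have hEcard : Ebad.toFinset.card = Ebad.ncard := (Set.ncard_eq_toFinset_card' Ebad).symm
  have hlog := log_add_le_of_le (n := n) (K := K) (a := 2 * d₀) (b := d₁) hL hK (by linarith)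
    hrL (by linarith) (by linarith)
  obtain ⟨F, h1, h2, h3, h4, h5⟩ := exists_twoFactorization_spreading (G := G) (H := H) (H' := H')
    (d₀ := d₀) (d₁ := d₁) (K := K) (d := d) (t := t) (μ := μ) (B := B) (E := Ebad.toFinset) hr0
    (by rw [Fintype.card_fin]; omega) hHG (fun v => by rw [hH]; ring) (fun v => by rw [hH']; ring)
    hdisj
    (fun v => by
      have : (deg G v : ℝ) ≤ maxDeg G := by exact_mod_cast deg_le_maxDeg G v
      linarith)
    (by linarith)
    (fun U => by
      have := (abs_le.1 (hjum' U)).2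
      have h' : 0 ≤ r / n * (U.card : ℝ) := by positivity
      rw [Fintype.card_fin]
      linarith)
    (fun U => by
      have := (abs_le.1 (hjum' U)).1
      rw [Fintype.card_fin]
      linarith)
    ht (by exact_mod_cast (by linarith : (1 : ℝ) ≤ d))
    (by exact_mod_cast (by linarith : (K + d : ℝ) ≤ t))
    (by exact_mod_cast (by linarith : (K : ℝ) ≤ d₀ + d₁)) (by exact_mod_cast hμ0)
    (by rwa [Fintype.card_fin]) (by exact_mod_cast hK0)
    (by exact_mod_cast (by linarith : (4 * (2 * (2 * d₁) + B) : ℝ) ≤ K))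
    (fun e he => hbad (Set.mem_toFinset.1 he))
    (by
      rw [hEcard]
      rw [div_le_iff₀' hμ0] at hB
      exact_mod_cast hB)
    (by rwa [Fintype.card_fin])
  rw [Fintype.card_fin] at h4
  refine ⟨fun i => F i, fun i => h1 i i.2, fun i j hij =>
    h2 i i.2 j j.2 (fun h => hij (Fin.ext h)), ?_, ?_, fun i => ⟨fun e he f hf hne => ?_, ?_⟩⟩
  · refine le_antisymm (iSup_le fun i => (h1 i i.2).1) fun v w hvw => ?_
    obtain ⟨i, hi, h⟩ := h3 v w hvw
    exact SimpleGraph.iSup_adj.2 ⟨⟨i, hi⟩, h⟩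
  · rw [Fin.sum_univ_eq_sum_range (fun i => (numCycles (F i) : ℝ))]
    have h6 := h4.trans (total_cycleBound_le hn1 (by exact_mod_cast (by linarith : (d : ℝ) ≤ n))
      (by exact_mod_cast (by linarith : (0 : ℝ) < d))
      (by exact_mod_cast (by linarith : (K : ℝ) ≤ 5 * d))
      ((Nat.sub_le _ _).trans (by exact_mod_cast (by linarith : (d₀ + d₁ : ℝ) ≤ n))))
    exact le_of_mul_le_mul_right (h6.trans (cycle_estimate hn0.le hL (by linarith)))
      (Real.log_pos one_lt_two)
  · exact (h5 i i.2).1 e (Set.mem_toFinset.2 he.2) he.1 f (Set.mem_toFinset.2 hf.2) hf.1 hne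
  · refine le_trans ?_ hμ
    refine Nat.cast_le.2 (le_trans (le_of_eq ?_) (h5 i i.2).2)
    rw [← Set.ncard_coe_finset]
    congr 1
    ext e
    simp [and_comm]
end

section
/- Let H be a graph on n vertices, and let P = x…y be a path whose vertex set is contained in V(H) and which is edge-disjoint from H. Let Q ⊆ V(P), and for each integer τ ≥ 1 let U_τ denote the set of (H, Q, τ)-reachable vertices of P. Then for every τ ≥ 1, |U_{τ+1}| ≥ (1/2)·|N_H(U_τ) ∩ Q| − |U_τ|. -/
open scoped Classical
open SimpleGraph

namespace EDHC

/-- `v` immediately follows `u` in the list `l`. -/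
def Follows {V : Type} (l : List V) (u v : V) : Prop :=
  ∃ i, l[i]? = some u ∧ l[i + 1]? = some v

/-- `u` and `v` are consecutive, in either order, in the list `l`. -/
def Consecutive {V : Type} (l : List V) (u v : V) : Prop :=
  Follows l u v ∨ Follows l v u

theorem Follows.mem_left {V : Type} {l : List V} {u v : V} (h : Follows l u v) : u ∈ l := by
  obtain ⟨i, hi, -⟩ := h
  exact List.mem_of_getElem? hi

theorem Follows.mem_right {V : Type} {l : List V} {u v : V} (h : Follows l u v) : v ∈ l := by
  obtain ⟨i, -, hi⟩ := h
  exact List.mem_of_getElem? hi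

theorem Consecutive.mem_left {V : Type} {l : List V} {u v : V} (h : Consecutive l u v) :
    u ∈ l :=
  h.elim Follows.mem_left Follows.mem_right

theorem Follows.right_unique {V : Type} {l : List V} (hl : l.Nodup) {u v w : V}
    (hv : Follows l u v) (hw : Follows l u w) : v = w := by
  obtain ⟨i, hi, hi'⟩ := hv
  obtain ⟨j, hj, hj'⟩ := hw
  obtain ⟨hil, -⟩ := List.getElem?_eq_some_iff.1 hi
  have hij : i = j := List.getElem?_inj hil hl |>.1 (hi.trans hj.symm)
  subst hij
  exact Option.some.inj (hi'.symm.trans hj')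

theorem Follows.left_unique {V : Type} {l : List V} (hl : l.Nodup) {u v w : V}
    (hv : Follows l v u) (hw : Follows l w u) : v = w := by
  obtain ⟨i, hi, hi'⟩ := hv
  obtain ⟨j, hj, hj'⟩ := hw
  obtain ⟨hil, -⟩ := List.getElem?_eq_some_iff.1 hi'
  have hij : i + 1 = j + 1 := List.getElem?_inj hil hl |>.1 (hi'.trans hj'.symm)
  obtain rfl : i = j := by omega
  exact Option.some.inj (hi.symm.trans hj)

/-- The vertices having a neighbour in `S` along a path number at most `2 |S|`. -/
theorem ncard_le_of_consecutive {V : Type} [Finite V] {l : List V} (hl : l.Nodup) {S N : Set V}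
    (h : ∀ v ∈ N, ∃ u ∈ S, Consecutive l u v) : N.ncard ≤ 2 * S.ncard := by
  have aux : ∀ (R : V → V → Prop), (∀ u v w, R u v → R u w → v = w) →
      {v | ∃ u ∈ S, R u v}.ncard ≤ S.ncard := by
    intro R hR
    choose! g hg using fun v (hv : v ∈ {v | ∃ u ∈ S, R u v}) => hv
    refine Set.ncard_le_ncard_of_injOn g (fun v hv => (hg v hv).1) ?_ (Set.toFinite _)
    intro v hv w hw hvw
    exact hR (g v) v w (hg v hv).2 (hvw ▸ (hg w hw).2)
  have hsub : N ⊆ {v | ∃ u ∈ S, Follows l u v} ∪ {v | ∃ u ∈ S, Follows l v u} := by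
    intro v hv
    obtain ⟨u, hu, huv | huv⟩ := h v hv
    · exact Or.inl ⟨u, hu, huv⟩
    · exact Or.inr ⟨u, hu, huv⟩
  have h₁ := aux (Follows l) fun _ _ _ => Follows.right_unique hl
  have h₂ := aux (fun u v => Follows l v u) fun _ _ _ => Follows.left_unique hl
  have h₃ := Set.ncard_le_ncard hsub (Set.toFinite _)
  have h₄ := Set.ncard_union_le {v | ∃ u ∈ S, Follows l u v} {v | ∃ u ∈ S, Follows l v u}
  omega

theorem RotStep.perm {V : Type} {H : SimpleGraph V} {Q : Set V} {l l' : List V}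
    (h : RotStep H Q l l') : l'.Perm l := by
  obtain ⟨x, a, p, b, rfl, rfl, -, -⟩ := h
  exact (List.reverse_perm _).append_right _

/-- If `p` occurs in `l` beside vertices satisfying `A` only, none of which is the first vertex
of `l'`, and `p` is not the first vertex of `l`, then the same holds in the rotation `l'`. -/
theorem RotStep.isChain {V : Type} {H : SimpleGraph V} {Q : Set V} {l l' : List V} {p : V}
    {A : V → Prop} (h : RotStep H Q l l')
    (hl : l.IsChain fun u v => (u = p → A v) ∧ (v = p → A u))
    (hp : l.head? ≠ some p) (hA : ∀ w, l'.head? = some w → w ≠ p ∧ ¬ A w) :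
    l'.IsChain fun u v => (u = p → A v) ∧ (v = p → A u) := by
  obtain ⟨x, a, q, b, rfl, rfl, -, -⟩ := h
  rw [List.isChain_append] at hl ⊢
  obtain ⟨h₁, h₂, h₃⟩ := hl
  refine ⟨?_, h₂, ?_⟩
  · rw [List.isChain_reverse]
    exact h₁.imp fun u v huv => ⟨huv.2, huv.1⟩
  · intro u hu v hv
    obtain rfl : x = u := by simpa using hu
    obtain rfl : q = v := by simpa using hv
    refine ⟨fun hxp => absurd (by simp [hxp]) hp, fun hqp => ?_⟩
    have hne : (x :: a) ≠ [] := by simp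
    have hlast := List.getLast?_eq_some_getLast hne
    exact absurd ((h₃ _ hlast q (by simp)).2 hqp) (hA _ (by
      rw [List.head?_append, List.head?_reverse, hlast]; rfl)).2

/-- Every pivot outside the reachable set that is adjacent to it lies on the path beside a vertex
reachable with one further rotation. -/
theorem exists_consecutive_reachableVert {V : Type} {H : SimpleGraph V} {Q : Set V} {l : List V}
    {τ : ℕ} {u p : V} (hpl : p ∈ l) (hpQ : p ∈ Q) (hp : ¬ ReachableVert H Q τ l p)
    (hu : ReachableVert H Q τ l u) (hup : H.Adj u p) :
    ∃ w, ReachableVert H Q (τ + 1) l w ∧ Consecutive l w p := by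
  by_contra! hno
  obtain ⟨k, f, hk, hf0, hf, hfk⟩ := hu
  have hreach : ∀ i ≤ k, ∀ w, (f i).head? = some w → ReachableVert H Q τ l w :=
    fun i hi w hw => ⟨i, f, hi.trans hk, hf0, fun j hj => hf j (hj.trans_le hi), hw⟩
  have hmono : ∀ w, ReachableVert H Q τ l w → ReachableVert H Q (τ + 1) l w := by
    rintro w ⟨j, g, hj, hg⟩
    exact ⟨j, g, hj.trans τ.le_succ, hg⟩
  have hinv : ∀ i ≤ k, (f i).Perm l ∧ (f i).IsChain fun v w =>
      (v = p → Consecutive l w p) ∧ (w = p → Consecutive l v p) := by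
    intro i
    induction i with
    | zero =>
      intro _
      rw [hf0]
      refine ⟨List.Perm.refl _, List.isChain_iff_getElem.2 fun i hi => ⟨fun h => ?_, fun h => ?_⟩⟩
      · exact Or.inr ⟨i, by rw [← h]; simp, by simp⟩
      · exact Or.inl ⟨i, by simp, by rw [← h]; simp⟩
    | succ i ih =>
      intro hi
      obtain ⟨hperm, hchain⟩ := ih (by omega)
      have hstep := hf i (by omega)
      refine ⟨hstep.perm.trans hperm, hstep.isChain hchain ?_ ?_⟩
      · exact fun h => hp (hreach i (by omega) p h)
      · intro w hw
        have hw' := hreach (i + 1) hi w hw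
        exact ⟨fun h => hp (h ▸ hw'), hno w (hmono w hw')⟩
  obtain ⟨hperm, hchain⟩ := hinv k le_rfl
  obtain ⟨s, b, hsb⟩ := List.append_of_mem (hperm.mem_iff.2 hpl)
  cases s with
  | nil => exact hp (hreach k le_rfl p (by simp [hsb]))
  | cons x a =>
    obtain rfl : x = u := by simpa [hsb] using hfk
    have hne : (x :: a) ≠ [] := by simp
    have hlast := List.getLast?_eq_some_getLast hne
    rw [hsb, List.isChain_append] at hchain
    refine hno ((x :: a).getLast hne) ?_ ((hchain.2.2 _ hlast p (by simp)).2 rfl)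
    refine ⟨k + 1, fun i => if i ≤ k then f i else (x :: a).reverse ++ p :: b, by omega,
      by simp [hf0], fun i hi => ?_, ?_⟩
    · rcases Nat.lt_or_ge i k with hik | hik
      · simpa [hik.le, Nat.succ_le_of_lt hik] using hf i hik
      · obtain rfl : i = k := by omega
        simp only [le_refl, if_true, if_neg (Nat.not_succ_le_self i)]
        exact ⟨x, a, p, b, hsb, rfl, hpQ, hup⟩
    · simp only [if_neg (Nat.not_succ_le_self k)]
      rw [List.head?_append, List.head?_reverse, hlast]
      rfl

end EDHC

open EDHC in
/-- Lemma 7.5 (expansion): reachable vertices expand. -/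
theorem stmt_19 {n : ℕ} (H : SimpleGraph (Fin n)) (l : List (Fin n)) (x y : Fin n)
    (hx : l.head? = some x) (hy : l.getLast? = some y) (hnd : l.Nodup)
    (hdisj : l.Chain' fun u v => ¬ H.Adj u v)
    (Q : Set (Fin n)) (hQ : Q ⊆ {v | v ∈ l}) :
    ∀ τ : ℕ, 1 ≤ τ →
      1 / 2 * ((extNbhd H {v | v ∈ l ∧ ReachableVert H Q τ l v} ∩ Q).ncard : ℝ)
          - ({v | v ∈ l ∧ ReachableVert H Q τ l v}.ncard : ℝ)
        ≤ ({v | v ∈ l ∧ ReachableVert H Q (τ + 1) l v}.ncard : ℝ) := by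
  intro τ _
  have key := ncard_le_of_consecutive hnd
    (S := {v | v ∈ l ∧ ReachableVert H Q (τ + 1) l v})
    (N := extNbhd H {v | v ∈ l ∧ ReachableVert H Q τ l v} ∩ Q) (by
      rintro p ⟨⟨hpN, hpU⟩, hpQ⟩
      simp only [Set.mem_iUnion] at hpN
      obtain ⟨u, hu, hup⟩ := hpN
      obtain ⟨w, hw, hwp⟩ := exists_consecutive_reachableVert (hQ hpQ) hpQ
        (fun h => hpU ⟨hQ hpQ, h⟩) hu.2 hup
      exact ⟨w, ⟨hwp.mem_left, hw⟩, hwp⟩)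
  have key' := (Nat.cast_le (α := ℝ)).2 key
  push_cast at key'
  have hU : (0 : ℝ) ≤ ({v | v ∈ l ∧ ReachableVert H Q τ l v}.ncard : ℝ) := Nat.cast_nonneg _
  linarith
end
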